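/- There exists a positive constant C depending only on β and the initial data such that for every T > 0: ∫₀ᵀ ∫₀¹ (w_x + u − θ)² dx dt ≤ C. -/

import Mathlib

open MeasureTheory Real Set Filter Topology

/-- A classical solution on `[0,1] × [0,∞)` of the rescaled stress-free
one-dimensional compressible Navier–Stokes system
`u_t + u = v_x`, `v_t = ((v_x - θ)/u)_x`,
`θ_t = -θ v_x/u + v_x²/u + (θ^β θ_x/u)_x` (β > 0),
with stress-free, thermally insulated boundary conditions and positive data. -/
structure NSSol where
  β : ℝ
  hβ : 0 < β
  u : ℝ → ℝ → ℝ
  v : ℝ → ℝ → ℝ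
  θ : ℝ → ℝ → ℝ
  ux : ℝ → ℝ → ℝ
  ut : ℝ → ℝ → ℝ
  vx : ℝ → ℝ → ℝ
  vt : ℝ → ℝ → ℝ
  vxx : ℝ → ℝ → ℝ
  θx : ℝ → ℝ → ℝ
  θt : ℝ → ℝ → ℝ
  θxx : ℝ → ℝ → ℝ
  hu_pos : ∀ x ∈ Icc (0:ℝ) 1, ∀ t ∈ Ici (0:ℝ), 0 < u x t
  hθ_pos : ∀ x ∈ Icc (0:ℝ) 1, ∀ t ∈ Ici (0:ℝ), 0 < θ x t
  hux : ∀ x ∈ Icc (0:ℝ) 1, ∀ t ∈ Ici (0:ℝ),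
    HasDerivWithinAt (fun y => u y t) (ux x t) (Icc 0 1) x
  hut : ∀ x ∈ Icc (0:ℝ) 1, ∀ t ∈ Ici (0:ℝ),
    HasDerivWithinAt (fun s => u x s) (ut x t) (Ici 0) t
  hvx : ∀ x ∈ Icc (0:ℝ) 1, ∀ t ∈ Ici (0:ℝ),
    HasDerivWithinAt (fun y => v y t) (vx x t) (Icc 0 1) x
  hvt : ∀ x ∈ Icc (0:ℝ) 1, ∀ t ∈ Ici (0:ℝ),
    HasDerivWithinAt (fun s => v x s) (vt x t) (Ici 0) t
  hvxx : ∀ x ∈ Icc (0:ℝ) 1, ∀ t ∈ Ici (0:ℝ),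
    HasDerivWithinAt (fun y => vx y t) (vxx x t) (Icc 0 1) x
  hθx : ∀ x ∈ Icc (0:ℝ) 1, ∀ t ∈ Ici (0:ℝ),
    HasDerivWithinAt (fun y => θ y t) (θx x t) (Icc 0 1) x
  hθt : ∀ x ∈ Icc (0:ℝ) 1, ∀ t ∈ Ici (0:ℝ),
    HasDerivWithinAt (fun s => θ x s) (θt x t) (Ici 0) t
  hθxx : ∀ x ∈ Icc (0:ℝ) 1, ∀ t ∈ Ici (0:ℝ),
    HasDerivWithinAt (fun y => θx y t) (θxx x t) (Icc 0 1) x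
  hu_cont : ContinuousOn (Function.uncurry u) (Icc 0 1 ×ˢ Ici 0)
  hv_cont : ContinuousOn (Function.uncurry v) (Icc 0 1 ×ˢ Ici 0)
  hθ_cont : ContinuousOn (Function.uncurry θ) (Icc 0 1 ×ˢ Ici 0)
  hux_cont : ContinuousOn (Function.uncurry ux) (Icc 0 1 ×ˢ Ici 0)
  hut_cont : ContinuousOn (Function.uncurry ut) (Icc 0 1 ×ˢ Ici 0)
  hvx_cont : ContinuousOn (Function.uncurry vx) (Icc 0 1 ×ˢ Ici 0)
  hvt_cont : ContinuousOn (Function.uncurry vt) (Icc 0 1 ×ˢ Ici 0)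
  hvxx_cont : ContinuousOn (Function.uncurry vxx) (Icc 0 1 ×ˢ Ici 0)
  hθx_cont : ContinuousOn (Function.uncurry θx) (Icc 0 1 ×ˢ Ici 0)
  hθt_cont : ContinuousOn (Function.uncurry θt) (Icc 0 1 ×ˢ Ici 0)
  hθxx_cont : ContinuousOn (Function.uncurry θxx) (Icc 0 1 ×ˢ Ici 0)
  mass : ∀ x ∈ Icc (0:ℝ) 1, ∀ t ∈ Ici (0:ℝ), ut x t + u x t = vx x t
  momentum : ∀ x ∈ Icc (0:ℝ) 1, ∀ t ∈ Ici (0:ℝ),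
    HasDerivWithinAt (fun y => (vx y t - θ y t) / u y t) (vt x t) (Icc 0 1) x
  energyEq : ∀ x ∈ Icc (0:ℝ) 1, ∀ t ∈ Ici (0:ℝ),
    HasDerivWithinAt (fun y => θ y t ^ β * θx y t / u y t)
      (θt x t + θ x t * vx x t / u x t - (vx x t) ^ 2 / u x t) (Icc 0 1) x
  bc0 : ∀ t ∈ Ici (0:ℝ), (vx 0 t - θ 0 t) / u 0 t = 0
  bc1 : ∀ t ∈ Ici (0:ℝ), (vx 1 t - θ 1 t) / u 1 t = 0
  bcθ0 : ∀ t ∈ Ici (0:ℝ), θx 0 t = 0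
  bcθ1 : ∀ t ∈ Ici (0:ℝ), θx 1 t = 0

namespace NSSol

/-- The initial energy `E₀ = ∫₀¹ (v₀²/2 + θ₀) dx`. -/
noncomputable def E₀ (S : NSSol) : ℝ := ∫ x in (0:ℝ)..1, ((S.v x 0) ^ 2 / 2 + S.θ x 0)

/-- The dissipation functional
`V(t) = ∫₀¹ (θ^β θ_x²/(uθ²) + (v_x − θ)²/(uθ)) dx`. -/
noncomputable def V (S : NSSol) (t : ℝ) : ℝ :=
  ∫ x in (0:ℝ)..1,
    (S.θ x t ^ S.β * (S.θx x t) ^ 2 / (S.u x t * (S.θ x t) ^ 2)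
      + (S.vx x t - S.θ x t) ^ 2 / (S.u x t * S.θ x t))

/-- The auxiliary velocity
`w(x,t) = v(x,t) − ∫₀¹ v₀ dξ − ∫₀ˣ u(ξ,t) dξ + ∫₀¹∫₀^ξ u(η,t) dη dξ`,
which satisfies `w_x = v_x − u` and `∫₀¹ w dx = 0`. -/
noncomputable def w (S : NSSol) (x t : ℝ) : ℝ :=
  S.v x t - (∫ ξ in (0:ℝ)..1, S.v ξ 0) - (∫ ξ in (0:ℝ)..x, S.u ξ t)
    + ∫ ξ in (0:ℝ)..1, ∫ η in (0:ℝ)..ξ, S.u η t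

/-- The asymptotic state `A = 2√(36 + 3(2E₀ − (∫₀¹ v₀ dx)²)) − 12`. -/
noncomputable def A (S : NSSol) : ℝ :=
  2 * Real.sqrt (36 + 3 * (2 * S.E₀ - (∫ x in (0:ℝ)..1, S.v x 0) ^ 2)) - 12

end NSSol

/-- Joint continuity on the space-time strip `[0,1] × [0,∞)`. -/
def JointCont (f : ℝ → ℝ → ℝ) : Prop :=
  ContinuousOn (Function.uncurry f) (Icc (0:ℝ) 1 ×ˢ Ici (0:ℝ))

namespace JointCont

variable {f g : ℝ → ℝ → ℝ}

theorem add (hf : JointCont f) (hg : JointCont g) : JointCont fun x t => f x t + g x t :=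
  ContinuousOn.add hf hg

theorem sub (hf : JointCont f) (hg : JointCont g) : JointCont fun x t => f x t - g x t :=
  ContinuousOn.sub hf hg

theorem mul (hf : JointCont f) (hg : JointCont g) : JointCont fun x t => f x t * g x t :=
  ContinuousOn.mul hf hg

theorem pow (hf : JointCont f) (n : ℕ) : JointCont fun x t => f x t ^ n :=
  ContinuousOn.pow hf n

theorem div (hf : JointCont f) (hg : JointCont g)
    (h0 : ∀ x ∈ Icc (0:ℝ) 1, ∀ t ∈ Ici (0:ℝ), g x t ≠ 0) :
    JointCont fun x t => f x t / g x t :=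
  ContinuousOn.div hf hg fun p hp => h0 p.1 hp.1 p.2 hp.2

theorem of_time {φ : ℝ → ℝ} (hφ : ContinuousOn φ (Ici 0)) : JointCont fun _ t => φ t :=
  hφ.comp continuousOn_snd fun _ hp => hp.2

theorem comp_pos {φ : ℝ → ℝ} (hf : JointCont f) (hφ : ContinuousOn φ (Ioi 0))
    (h0 : ∀ x ∈ Icc (0:ℝ) 1, ∀ t ∈ Ici (0:ℝ), 0 < f x t) :
    JointCont fun x t => φ (f x t) :=
  ContinuousOn.comp hφ hf fun p hp => h0 p.1 hp.1 p.2 hp.2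

theorem slice_space (hf : JointCont f) {t : ℝ} (ht : t ∈ Ici (0:ℝ)) :
    ContinuousOn (fun x => f x t) (Icc 0 1) :=
  ContinuousOn.comp hf (f := fun x : ℝ => (x, t)) (by fun_prop) fun _ hx => ⟨hx, ht⟩

theorem slice_time (hf : JointCont f) {x : ℝ} (hx : x ∈ Icc (0:ℝ) 1) :
    ContinuousOn (fun t => f x t) (Ici 0) :=
  ContinuousOn.comp hf (f := fun t : ℝ => (x, t)) (by fun_prop) fun _ ht => ⟨hx, ht⟩

theorem intervalIntegrable_space (hf : JointCont f) {t : ℝ} (ht : t ∈ Ici (0:ℝ)) {a b : ℝ}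
    (ha : a ∈ Icc (0:ℝ) 1) (hb : b ∈ Icc (0:ℝ) 1) :
    IntervalIntegrable (fun x => f x t) volume a b :=
  ((hf.slice_space ht).mono (uIcc_subset_Icc ha hb)).intervalIntegrable

theorem intervalIntegrable_unit (hf : JointCont f) {t : ℝ} (ht : t ∈ Ici (0:ℝ)) :
    IntervalIntegrable (fun x => f x t) volume 0 1 :=
  hf.intervalIntegrable_space ht (by simp) (by simp)

theorem intervalIntegrable_time (hf : JointCont f) {x : ℝ} (hx : x ∈ Icc (0:ℝ) 1) {a b : ℝ}
    (ha : 0 ≤ a) (hb : 0 ≤ b) :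
    IntervalIntegrable (fun t => f x t) volume a b :=
  ((hf.slice_time hx).mono fun _ hs => (le_min ha hb).trans hs.1).intervalIntegrable

theorem exists_extension (hf : JointCont f) : ∃ F : ℝ → ℝ → ℝ, Continuous (Function.uncurry F) ∧
    ∀ x ∈ Icc (0:ℝ) 1, ∀ t ∈ Ici (0:ℝ), F x t = f x t := by
  refine ⟨fun x t => f (max 0 (min x 1)) (max t 0), ?_, ?_⟩
  · refine ContinuousOn.comp_continuous (f := fun p : ℝ × ℝ => (max 0 (min p.1 1), max p.2 0))
      hf (by fun_prop) fun p => ⟨⟨le_max_left _ _, max_le zero_le_one (min_le_right _ _)⟩,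
        le_max_right p.2 0⟩
  · intro x hx t ht
    simp only [min_eq_left hx.2, max_eq_right hx.1, max_eq_left (mem_Ici.1 ht)]

theorem continuousOn_integral (hf : JointCont f) {b : ℝ} (hb : b ∈ Icc (0:ℝ) 1) :
    ContinuousOn (fun t => ∫ x in (0:ℝ)..b, f x t) (Ici 0) := by
  obtain ⟨F, hF, hFf⟩ := hf.exists_extension
  have h : Continuous fun t => ∫ x in (0:ℝ)..b, F x t :=
    intervalIntegral.continuous_parametric_intervalIntegral_of_continuous'
      (f := fun t x => F x t) (hF.comp continuous_swap) 0 b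
  refine h.continuousOn.congr fun t ht => intervalIntegral.integral_congr fun x hx => ?_
  rw [uIcc_of_le hb.1] at hx
  exact (hFf x ⟨hx.1, hx.2.trans hb.2⟩ t ht).symm

theorem intervalIntegrable_integral (hf : JointCont f) {a b : ℝ} (ha : 0 ≤ a) (hb : 0 ≤ b) :
    IntervalIntegrable (fun t => ∫ x in (0:ℝ)..1, f x t) volume a b :=
  ((hf.continuousOn_integral (by simp)).mono
    fun _ hs => (le_min ha hb).trans hs.1).intervalIntegrable

theorem integral_swap (hf : JointCont f) {b T : ℝ} (hb : b ∈ Icc (0:ℝ) 1) (hT : 0 ≤ T) :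
    ∫ x in (0:ℝ)..b, ∫ t in (0:ℝ)..T, f x t = ∫ t in (0:ℝ)..T, ∫ x in (0:ℝ)..b, f x t := by
  obtain ⟨F, hF, hFf⟩ := hf.exists_extension
  have hx' : ∀ x ∈ uIcc (0:ℝ) b, x ∈ Icc (0:ℝ) 1 := fun x hx => by
    rw [uIcc_of_le hb.1] at hx
    exact ⟨hx.1, hx.2.trans hb.2⟩
  have ht' : ∀ t ∈ uIcc (0:ℝ) T, t ∈ Ici (0:ℝ) := fun t ht => by
    rw [uIcc_of_le hT] at ht
    exact ht.1
  have h₁ : ∫ x in (0:ℝ)..b, ∫ t in (0:ℝ)..T, f x t = ∫ x in (0:ℝ)..b, ∫ t in (0:ℝ)..T, F x t :=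
    intervalIntegral.integral_congr fun x hx => intervalIntegral.integral_congr fun t ht =>
      (hFf x (hx' x hx) t (ht' t ht)).symm
  have h₂ : ∫ t in (0:ℝ)..T, ∫ x in (0:ℝ)..b, f x t = ∫ t in (0:ℝ)..T, ∫ x in (0:ℝ)..b, F x t :=
    intervalIntegral.integral_congr fun t ht => intervalIntegral.integral_congr fun x hx =>
      (hFf x (hx' x hx) t (ht' t ht)).symm
  rw [h₁, h₂]
  refine intervalIntegral_intervalIntegral_swap ?_
  exact (hF.continuousOn.integrableOn_compact (isCompact_uIcc.prod isCompact_uIcc)).mono_set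
    (prod_mono uIoc_subset_uIcc uIoc_subset_uIcc)

theorem integral_time_deriv (hf : JointCont f) (hg : JointCont g)
    (hd : ∀ x ∈ Icc (0:ℝ) 1, ∀ t ∈ Ici (0:ℝ), HasDerivWithinAt (fun s => f x s) (g x t) (Ici 0) t)
    {b T : ℝ} (hb : b ∈ Icc (0:ℝ) 1) (hT : 0 ≤ T) :
    (∫ x in (0:ℝ)..b, f x T) - ∫ x in (0:ℝ)..b, f x 0 =
      ∫ t in (0:ℝ)..T, ∫ x in (0:ℝ)..b, g x t := by
  rw [← hg.integral_swap hb hT, ← intervalIntegral.integral_sub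
    (hf.intervalIntegrable_space (mem_Ici.2 hT) (by simp) hb)
    (hf.intervalIntegrable_space (mem_Ici.2 le_rfl) (by simp) hb)]
  refine intervalIntegral.integral_congr fun x hx => ?_
  rw [uIcc_of_le hb.1] at hx
  have hx1 : x ∈ Icc (0:ℝ) 1 := ⟨hx.1, hx.2.trans hb.2⟩
  exact (intervalIntegral.integral_eq_sub_of_hasDerivAt_of_le hT
    ((hf.slice_time hx1).mono fun s hs => hs.1)
    (fun t ht => (hd x hx1 t ht.1.le).hasDerivAt (Ici_mem_nhds ht.1))
    (hg.intervalIntegrable_time hx1 le_rfl hT)).symm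

theorem integral_le (hf : JointCont f) (hg : JointCont g) {t : ℝ} (ht : t ∈ Ici (0:ℝ))
    (h : ∀ x ∈ Icc (0:ℝ) 1, f x t ≤ g x t) :
    ∫ x in (0:ℝ)..1, f x t ≤ ∫ x in (0:ℝ)..1, g x t :=
  intervalIntegral.integral_mono_on zero_le_one (hf.intervalIntegrable_unit ht)
    (hg.intervalIntegrable_unit ht) h

theorem integral_integral_le (hf : JointCont f) (hg : JointCont g) {T : ℝ} (hT : 0 ≤ T)
    (h : ∀ x ∈ Icc (0:ℝ) 1, ∀ t ∈ Ici (0:ℝ), f x t ≤ g x t) :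
    ∫ t in (0:ℝ)..T, ∫ x in (0:ℝ)..1, f x t ≤ ∫ t in (0:ℝ)..T, ∫ x in (0:ℝ)..1, g x t :=
  intervalIntegral.integral_mono_on hT (hf.intervalIntegrable_integral le_rfl hT)
    (hg.intervalIntegrable_integral le_rfl hT) fun t ht =>
      hf.integral_le hg ht.1 fun x hx => h x hx t ht.1

theorem integral_add (hf : JointCont f) (hg : JointCont g) {t : ℝ} (ht : t ∈ Ici (0:ℝ)) :
    ∫ x in (0:ℝ)..1, (f x t + g x t) = (∫ x in (0:ℝ)..1, f x t) + ∫ x in (0:ℝ)..1, g x t :=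
  intervalIntegral.integral_add (hf.intervalIntegrable_unit ht) (hg.intervalIntegrable_unit ht)

theorem integral_integral_add (hf : JointCont f) (hg : JointCont g) {T : ℝ} (hT : 0 ≤ T) :
    ∫ t in (0:ℝ)..T, ∫ x in (0:ℝ)..1, (f x t + g x t) =
      (∫ t in (0:ℝ)..T, ∫ x in (0:ℝ)..1, f x t) + ∫ t in (0:ℝ)..T, ∫ x in (0:ℝ)..1, g x t := by
  rw [← intervalIntegral.integral_add (hf.intervalIntegrable_integral le_rfl hT)
    (hg.intervalIntegrable_integral le_rfl hT)]
  refine intervalIntegral.integral_congr fun t ht => ?_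
  rw [uIcc_of_le hT] at ht
  exact hf.integral_add hg ht.1

theorem const_mul (hf : JointCont f) (c : ℝ) : JointCont fun x t => c * f x t :=
  ContinuousOn.mul continuousOn_const hf

end JointCont

theorem integral_eq_sub_of_hasDerivWithinAt_unit {f f' : ℝ → ℝ}
    (hf : ∀ x ∈ Icc (0:ℝ) 1, HasDerivWithinAt f (f' x) (Icc 0 1) x)
    (hf' : ContinuousOn f' (Icc 0 1)) {a b : ℝ} (ha : 0 ≤ a) (hab : a ≤ b) (hb : b ≤ 1) :
    ∫ x in a..b, f' x = f b - f a := by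
  have hsub : Icc a b ⊆ Icc (0:ℝ) 1 := Icc_subset_Icc ha hb
  refine intervalIntegral.integral_eq_sub_of_hasDerivAt_of_le hab
    (fun x hx => ((hf x (hsub hx)).continuousWithinAt).mono hsub)
    (fun x hx => (hf x (hsub (Ioo_subset_Icc_self hx))).hasDerivAt
      (Icc_mem_nhds (ha.trans_lt hx.1) (hx.2.trans_le hb))) ?_
  refine ContinuousOn.intervalIntegrable ?_
  rw [uIcc_of_le hab]
  exact hf'.mono hsub

namespace NSSol

variable (S : NSSol)

/-- The effective stress `σ = (v_x − θ)/u`. -/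
noncomputable def stress (x t : ℝ) : ℝ := (S.vx x t - S.θ x t) / S.u x t

/-- The integrand of the entropy production due to heat conduction, with a general weight. -/
noncomputable def conduction (φ : ℝ → ℝ) (x t : ℝ) : ℝ :=
  φ (S.θ x t) * (S.θ x t ^ S.β * S.θx x t ^ 2 / S.u x t)

theorem jointCont_u : JointCont S.u := S.hu_cont
theorem jointCont_v : JointCont S.v := S.hv_cont
theorem jointCont_θ : JointCont S.θ := S.hθ_cont
theorem jointCont_vx : JointCont S.vx := S.hvx_cont
theorem jointCont_vt : JointCont S.vt := S.hvt_cont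
theorem jointCont_θx : JointCont S.θx := S.hθx_cont
theorem jointCont_θt : JointCont S.θt := S.hθt_cont

theorem u_ne_zero : ∀ x ∈ Icc (0:ℝ) 1, ∀ t ∈ Ici (0:ℝ), S.u x t ≠ 0 :=
  fun x hx t ht => (S.hu_pos x hx t ht).ne'

theorem jointCont_stress : JointCont S.stress :=
  (S.jointCont_vx.sub S.jointCont_θ).div S.jointCont_u S.u_ne_zero

theorem jointCont_comp_θ {φ : ℝ → ℝ} (hφ : ContinuousOn φ (Ioi 0)) :
    JointCont fun x t => φ (S.θ x t) :=
  S.jointCont_θ.comp_pos hφ S.hθ_pos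

theorem jointCont_conduction {φ : ℝ → ℝ} (hφ : ContinuousOn φ (Ioi 0)) :
    JointCont (S.conduction φ) := by
  have hpow : ContinuousOn (fun y : ℝ => y ^ S.β) (Ioi 0) :=
    fun y hy => (Real.continuousAt_rpow_const y S.β (Or.inl (ne_of_gt hy))).continuousWithinAt
  exact (S.jointCont_comp_θ hφ).mul
    (((S.jointCont_comp_θ hpow).mul (S.jointCont_θx.pow 2)).div S.jointCont_u S.u_ne_zero)

theorem vx_eq {x t : ℝ} (hx : x ∈ Icc (0:ℝ) 1) (ht : t ∈ Ici (0:ℝ)) :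
    S.vx x t = S.u x t * S.stress x t + S.θ x t := by
  have := S.u_ne_zero x hx t ht
  unfold stress
  field_simp
  ring

theorem hasDerivWithinAt_stress {x t : ℝ} (hx : x ∈ Icc (0:ℝ) 1) (ht : t ∈ Ici (0:ℝ)) :
    HasDerivWithinAt (fun y => S.stress y t) (S.vt x t) (Icc 0 1) x :=
  S.momentum x hx t ht

theorem integral_vt {x t : ℝ} (hx : x ∈ Icc (0:ℝ) 1) (ht : t ∈ Ici (0:ℝ)) :
    ∫ y in (0:ℝ)..x, S.vt y t = S.stress x t := by
  rw [integral_eq_sub_of_hasDerivWithinAt_unit (f := fun y => S.stress y t)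
    (fun y hy => S.hasDerivWithinAt_stress hy ht) (S.jointCont_vt.slice_space ht) le_rfl hx.1 hx.2]
  simp only [show S.stress 0 t = 0 from S.bc0 t ht, sub_zero]

theorem hasDerivWithinAt_heatFlux {x t : ℝ} (hx : x ∈ Icc (0:ℝ) 1) (ht : t ∈ Ici (0:ℝ)) :
    HasDerivWithinAt (fun y => S.θ y t ^ S.β * S.θx y t / S.u y t)
      (S.θt x t - S.stress x t * S.vx x t) (Icc 0 1) x := by
  convert S.energyEq x hx t ht using 1
  have := S.u_ne_zero x hx t ht
  unfold stress
  field_simp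
  ring

/-- Weak form of the temperature equation, tested against a function of the temperature. -/
theorem temperature_test {G g g' : ℝ → ℝ} (hG : ∀ y > 0, HasDerivAt G (g y) y)
    (hg : ∀ y > 0, HasDerivAt g (g' y) y) (hg' : ContinuousOn g' (Ioi 0)) {T : ℝ} (hT : 0 ≤ T) :
    (∫ x in (0:ℝ)..1, G (S.θ x T)) - ∫ x in (0:ℝ)..1, G (S.θ x 0) =
      ∫ t in (0:ℝ)..T, ∫ x in (0:ℝ)..1,
        (g (S.θ x t) * (S.stress x t * S.vx x t) - S.conduction g' x t) := by
  have hgc : ContinuousOn g (Ioi 0) := fun y hy => (hg y hy).continuousAt.continuousWithinAt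
  have hGc : ContinuousOn G (Ioi 0) := fun y hy => (hG y hy).continuousAt.continuousWithinAt
  have hgθ := S.jointCont_comp_θ hgc
  rw [JointCont.integral_time_deriv (f := fun x t => G (S.θ x t))
    (g := fun x t => g (S.θ x t) * S.θt x t) (S.jointCont_comp_θ hGc) (hgθ.mul S.jointCont_θt)
    (fun x hx t ht => (hG _ (S.hθ_pos x hx t ht)).comp_hasDerivWithinAt t (S.hθt x hx t ht))
    (by simp) hT]
  refine intervalIntegral.integral_congr fun t ht => ?_
  rw [uIcc_of_le hT] at ht
  have ht0 : t ∈ Ici (0:ℝ) := ht.1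
  have hsrc := hgθ.mul (S.jointCont_stress.mul S.jointCont_vx)
  have hcond := S.jointCont_conduction hg'
  have hftc := integral_eq_sub_of_hasDerivWithinAt_unit
    (f := fun y => g (S.θ y t) * (S.θ y t ^ S.β * S.θx y t / S.u y t))
    (f' := fun y => g (S.θ y t) * S.θt y t -
      (g (S.θ y t) * (S.stress y t * S.vx y t) - S.conduction g' y t))
    (fun x hx => by
      refine (((hg _ (S.hθ_pos x hx t ht0)).comp_hasDerivWithinAt x (S.hθx x hx t ht0)).mul
        (S.hasDerivWithinAt_heatFlux hx ht0)).congr_deriv ?_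
      simp only [Function.comp, conduction]
      ring)
    (((hgθ.mul S.jointCont_θt).sub (hsrc.sub hcond)).slice_space ht0) le_rfl zero_le_one le_rfl
  rw [intervalIntegral.integral_sub ((hgθ.mul S.jointCont_θt).intervalIntegrable_unit ht0)
    ((hsrc.sub hcond).intervalIntegrable_unit ht0)] at hftc
  simp only [S.bcθ0 t ht0, S.bcθ1 t ht0, mul_zero, zero_div, sub_zero] at hftc
  exact sub_eq_zero.1 hftc

theorem jointCont_energyDensity : JointCont fun x t => S.v x t ^ 2 / 2 + S.θ x t := by
  have h := (S.jointCont_v.pow 2).const_mul (1 / 2)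
  convert h.add S.jointCont_θ using 4
  ring

theorem energy_conservation {T : ℝ} (hT : 0 ≤ T) :
    ∫ x in (0:ℝ)..1, (S.v x T ^ 2 / 2 + S.θ x T) = S.E₀ := by
  have hdc : JointCont fun x t => S.v x t * S.vt x t + S.θt x t :=
    (S.jointCont_v.mul S.jointCont_vt).add S.jointCont_θt
  have h := JointCont.integral_time_deriv S.jointCont_energyDensity hdc (fun x hx t ht => by
    refine ((((S.hvt x hx t ht).pow 2).div_const 2).add (S.hθt x hx t ht)).congr_deriv ?_
    simp only [Nat.cast_ofNat, Nat.add_one_sub_one, pow_one]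
    ring) (b := 1) (by simp) hT
  have hz : ∫ t in (0:ℝ)..T, ∫ x in (0:ℝ)..1, (S.v x t * S.vt x t + S.θt x t) = 0 := by
    refine intervalIntegral.integral_zero_ae (Eventually.of_forall fun t ht => ?_)
    rw [uIoc_of_le hT] at ht
    have ht0 : t ∈ Ici (0:ℝ) := ht.1.le
    have hftc := integral_eq_sub_of_hasDerivWithinAt_unit
      (f := fun y => S.v y t * S.stress y t + S.θ y t ^ S.β * S.θx y t / S.u y t)
      (f' := fun y => S.v y t * S.vt y t + S.θt y t)
      (fun x hx => by
        refine (((S.hvx x hx t ht0).mul (S.hasDerivWithinAt_stress hx ht0)).add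
          (S.hasDerivWithinAt_heatFlux hx ht0)).congr_deriv ?_
        ring)
      (hdc.slice_space ht0) le_rfl zero_le_one le_rfl
    simpa [S.bcθ0 t ht0, S.bcθ1 t ht0, show S.stress 0 t = 0 from S.bc0 t ht0,
      show S.stress 1 t = 0 from S.bc1 t ht0] using hftc
  rw [hz] at h
  exact sub_eq_zero.1 h

theorem integral_θ_le {t : ℝ} (ht : t ∈ Ici (0:ℝ)) : ∫ x in (0:ℝ)..1, S.θ x t ≤ S.E₀ := by
  rw [← S.energy_conservation ht]
  exact S.jointCont_θ.integral_le S.jointCont_energyDensity ht fun x _ => by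
    linarith [sq_nonneg (S.v x t)]

end NSSol

theorem exists_le_of_le_integral_unit {f : ℝ → ℝ} (hf : ContinuousOn f (Icc 0 1)) {c : ℝ}
    (hc : c ≤ ∫ x in (0:ℝ)..1, f x) : ∃ x ∈ Icc (0:ℝ) 1, c ≤ f x := by
  obtain ⟨x, hx, hmax⟩ := isCompact_Icc.exists_isMaxOn (nonempty_Icc.2 zero_le_one) hf
  refine ⟨x, hx, hc.trans ?_⟩
  have h := intervalIntegral.integral_mono_on (μ := volume) zero_le_one
    (hf.intervalIntegrable_of_Icc zero_le_one) (intervalIntegrable_const (c := f x))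
    fun y hy => hmax hy
  simpa using h

theorem exists_ge_of_integral_unit_le {f : ℝ → ℝ} (hf : ContinuousOn f (Icc 0 1)) {c : ℝ}
    (hc : ∫ x in (0:ℝ)..1, f x ≤ c) : ∃ x ∈ Icc (0:ℝ) 1, f x ≤ c := by
  obtain ⟨x, hx, h⟩ := exists_le_of_le_integral_unit hf.neg (c := -c) (by
    simpa [intervalIntegral.integral_neg] using hc)
  exact ⟨x, hx, neg_le_neg_iff.1 h⟩

theorem integral_exp_sub_le_one (T : ℝ) : ∫ t in (0:ℝ)..T, Real.exp (t - T) ≤ 1 := by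
  have h : ∫ t in (0:ℝ)..T, Real.exp (t - T) = Real.exp (T - T) - Real.exp (0 - T) :=
    intervalIntegral.integral_eq_sub_of_hasDerivAt
      (fun t _ => by simpa using ((hasDerivAt_id t).sub_const T).exp)
      (Continuous.intervalIntegrable (by fun_prop) _ _)
  rw [h, sub_self, Real.exp_zero]
  linarith [Real.exp_pos (0 - T)]

namespace NSSol

variable (S : NSSol)

/-- The time integral of the stress, expressed through the velocity. -/
noncomputable def impulse (x t : ℝ) : ℝ := (∫ y in (0:ℝ)..x, S.v y t) - ∫ y in (0:ℝ)..x, S.v y 0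

theorem impulse_eq {x T : ℝ} (hx : x ∈ Icc (0:ℝ) 1) (hT : 0 ≤ T) :
    S.impulse x T = ∫ t in (0:ℝ)..T, S.stress x t := by
  unfold impulse
  rw [S.jointCont_v.integral_time_deriv S.jointCont_vt S.hvt hx hT]
  refine intervalIntegral.integral_congr fun t ht => ?_
  rw [uIcc_of_le hT] at ht
  exact S.integral_vt hx ht.1

theorem abs_integral_v_le {x t : ℝ} (hx : x ∈ Icc (0:ℝ) 1) (ht : t ∈ Ici (0:ℝ)) :
    |∫ y in (0:ℝ)..x, S.v y t| ≤ S.E₀ + 1 / 2 := by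
  have hc := S.jointCont_energyDensity.add (JointCont.of_time (φ := fun _ => 1 / 2)
    continuousOn_const)
  have hle : ∀ y ∈ Icc (0:ℝ) 1, |S.v y t| ≤ S.v y t ^ 2 / 2 + S.θ y t + 1 / 2 := fun y hy => by
    have := S.hθ_pos y hy t ht
    rcases abs_cases (S.v y t) with h | h <;> rw [h.1] <;>
      nlinarith [sq_nonneg (S.v y t - 1), sq_nonneg (S.v y t + 1)]
  calc |∫ y in (0:ℝ)..x, S.v y t| ≤ ∫ y in (0:ℝ)..x, |S.v y t| :=
        intervalIntegral.abs_integral_le_integral_abs hx.1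
    _ ≤ ∫ y in (0:ℝ)..x, (S.v y t ^ 2 / 2 + S.θ y t + 1 / 2) :=
        intervalIntegral.integral_mono_on hx.1
          (S.jointCont_v.intervalIntegrable_space ht (by simp) hx).abs
          (hc.intervalIntegrable_space ht (by simp) hx)
          fun y hy => hle y ⟨hy.1, hy.2.trans hx.2⟩
    _ ≤ ∫ y in (0:ℝ)..1, (S.v y t ^ 2 / 2 + S.θ y t + 1 / 2) := by
        refine intervalIntegral.integral_mono_interval le_rfl hx.1 hx.2 ?_
          (hc.intervalIntegrable_unit ht)
        filter_upwards [ae_restrict_mem measurableSet_Ioc] with y hy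
        exact (abs_nonneg _).trans (hle y (Ioc_subset_Icc_self hy))
    _ = S.E₀ + 1 / 2 := by
        rw [intervalIntegral.integral_add (S.jointCont_energyDensity.intervalIntegrable_unit ht)
          intervalIntegrable_const, S.energy_conservation ht]
        simp

theorem abs_impulse_le {x t : ℝ} (hx : x ∈ Icc (0:ℝ) 1) (ht : t ∈ Ici (0:ℝ)) :
    |S.impulse x t| ≤ 2 * S.E₀ + 1 := by
  have h₁ := abs_sub (∫ y in (0:ℝ)..x, S.v y t) (∫ y in (0:ℝ)..x, S.v y 0)
  have h₂ := S.abs_integral_v_le hx ht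
  have h₃ := S.abs_integral_v_le hx (mem_Ici.2 le_rfl)
  unfold impulse
  linarith

theorem continuousOn_impulse {x : ℝ} (hx : x ∈ Icc (0:ℝ) 1) :
    ContinuousOn (fun t => S.impulse x t) (Ici 0) :=
  (S.jointCont_v.continuousOn_integral hx).sub continuousOn_const

theorem hasDerivAt_impulse {x t : ℝ} (hx : x ∈ Icc (0:ℝ) 1) (ht : 0 < t) :
    HasDerivAt (fun s => S.impulse x s) (S.stress x t) t := by
  have hc := S.jointCont_stress.slice_time hx
  have h := intervalIntegral.integral_hasDerivAt_right
    (S.jointCont_stress.intervalIntegrable_time hx le_rfl ht.le)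
    ((hc.mono Ioi_subset_Ici_self).stronglyMeasurableAtFilter isOpen_Ioi t ht)
    (hc.continuousAt (Ici_mem_nhds ht))
  refine h.congr_of_eventuallyEq ?_
  filter_upwards [Ici_mem_nhds ht] with s hs
  exact S.impulse_eq hx hs

theorem u_representation {x T : ℝ} (hx : x ∈ Icc (0:ℝ) 1) (hT : 0 ≤ T) :
    S.u x T * Real.exp (T - S.impulse x T) =
      S.u x 0 + ∫ t in (0:ℝ)..T, Real.exp (t - S.impulse x t) * S.θ x t := by
  have hexp : ContinuousOn (fun t => Real.exp (t - S.impulse x t)) (Ici 0) :=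
    Real.continuous_exp.comp_continuousOn (continuousOn_id.sub (S.continuousOn_impulse hx))
  have h := intervalIntegral.integral_eq_sub_of_hasDerivAt_of_le hT
    (f := fun t => S.u x t * Real.exp (t - S.impulse x t))
    (f' := fun t => Real.exp (t - S.impulse x t) * S.θ x t)
    (((S.jointCont_u.slice_time hx).mul hexp).mono fun t ht => ht.1)
    (fun t ht => by
      refine (((S.hut x hx t ht.1.le).hasDerivAt (Ici_mem_nhds ht.1)).mul
        ((hasDerivAt_id t).sub (S.hasDerivAt_impulse hx ht.1)).exp).congr_deriv ?_
      have h₁ := S.mass x hx t ht.1.le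
      rw [S.vx_eq hx ht.1.le] at h₁
      simp only [Pi.sub_apply, id]
      linear_combination Real.exp (t - S.impulse x t) * h₁)
    (((hexp.mul (S.jointCont_θ.slice_time hx)).mono fun t ht => by
      rw [uIcc_of_le hT] at ht
      exact ht.1).intervalIntegrable)
  rw [h]
  simp [impulse]

theorem u_bounds {x T : ℝ} (hx : x ∈ Icc (0:ℝ) 1) (hT : 0 ≤ T) :
    S.u x T ≤ Real.exp (2 * (2 * S.E₀ + 1)) *
        (S.u x 0 + ∫ t in (0:ℝ)..T, Real.exp (t - T) * S.θ x t) ∧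
      Real.exp (-(2 * (2 * S.E₀ + 1))) *
        (Real.exp (-T) * S.u x 0 + ∫ t in (0:ℝ)..T, Real.exp (t - T) * S.θ x t) ≤ S.u x T := by
  set B := 2 * S.E₀ + 1 with hB
  have hexp : ContinuousOn (fun t => Real.exp (t - S.impulse x t)) (Ici 0) :=
    Real.continuous_exp.comp_continuousOn (continuousOn_id.sub (S.continuousOn_impulse hx))
  have hsub : uIcc 0 T ⊆ Ici (0:ℝ) := fun t ht => by
    rw [uIcc_of_le hT] at ht
    exact ht.1
  have hI : IntervalIntegrable (fun t => Real.exp (t - S.impulse x t) * S.θ x t) volume 0 T :=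
    ((hexp.mul (S.jointCont_θ.slice_time hx)).mono hsub).intervalIntegrable
  have hJ : IntervalIntegrable (fun t => Real.exp (t - T) * S.θ x t) volume 0 T := by
    refine (ContinuousOn.mono (s := Ici (0:ℝ)) ?_ hsub).intervalIntegrable
    exact (Continuous.continuousOn (by fun_prop)).mul (S.jointCont_θ.slice_time hx)
  have hu0 := S.hu_pos x hx 0 (mem_Ici.2 le_rfl)
  have hTB := abs_le.1 (S.abs_impulse_le hx (mem_Ici.2 hT))
  rw [← hB] at hTB
  have hB0 : 0 ≤ B := by linarith
  have hrep : S.u x T = Real.exp (S.impulse x T) * (Real.exp (-T) * S.u x 0 +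
      Real.exp (-T) * ∫ t in (0:ℝ)..T, Real.exp (t - S.impulse x t) * S.θ x t) := by
    have h := S.u_representation hx hT
    rw [← mul_add, ← h, Real.exp_sub, Real.exp_neg]
    field_simp
  have hJpos : 0 ≤ ∫ t in (0:ℝ)..T, Real.exp (t - T) * S.θ x t :=
    intervalIntegral.integral_nonneg hT fun t ht =>
      mul_nonneg (Real.exp_pos _).le (S.hθ_pos x hx t ht.1).le
  have hle : Real.exp (-T) * ∫ t in (0:ℝ)..T, Real.exp (t - S.impulse x t) * S.θ x t ≤
      Real.exp B * ∫ t in (0:ℝ)..T, Real.exp (t - T) * S.θ x t := by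
    rw [← intervalIntegral.integral_const_mul, ← intervalIntegral.integral_const_mul]
    refine intervalIntegral.integral_mono_on hT (hI.const_mul _) (hJ.const_mul _) fun t ht => ?_
    rw [← mul_assoc, ← mul_assoc, ← Real.exp_add, ← Real.exp_add]
    refine mul_le_mul_of_nonneg_right (Real.exp_le_exp.2 ?_) (S.hθ_pos x hx t ht.1).le
    linarith [(abs_le.1 (S.abs_impulse_le hx (mem_Ici.2 ht.1))).1]
  have hge : Real.exp (-B) * (∫ t in (0:ℝ)..T, Real.exp (t - T) * S.θ x t) ≤
      Real.exp (-T) * ∫ t in (0:ℝ)..T, Real.exp (t - S.impulse x t) * S.θ x t := by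
    rw [← intervalIntegral.integral_const_mul, ← intervalIntegral.integral_const_mul]
    refine intervalIntegral.integral_mono_on hT (hJ.const_mul _) (hI.const_mul _) fun t ht => ?_
    rw [← mul_assoc, ← mul_assoc, ← Real.exp_add, ← Real.exp_add]
    refine mul_le_mul_of_nonneg_right (Real.exp_le_exp.2 ?_) (S.hθ_pos x hx t ht.1).le
    linarith [(abs_le.1 (S.abs_impulse_le hx (mem_Ici.2 ht.1))).2]
  have hT1 : Real.exp (-T) ≤ 1 := Real.exp_le_one_iff.2 (by linarith)
  have hB1 : 1 ≤ Real.exp B := Real.one_le_exp hB0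
  have hB2 : Real.exp (-B) ≤ 1 := Real.exp_le_one_iff.2 (by linarith)
  constructor
  · rw [hrep, two_mul, Real.exp_add, mul_assoc]
    refine mul_le_mul (Real.exp_le_exp.2 hTB.2) ?_ ?_ (Real.exp_pos _).le
    · rw [mul_add]
      refine add_le_add (mul_le_mul_of_nonneg_right (hT1.trans hB1) hu0.le) hle
    · exact add_nonneg (mul_nonneg (Real.exp_pos _).le hu0.le)
        ((mul_nonneg (Real.exp_pos _).le hJpos).trans hge)
  · rw [hrep, two_mul, neg_add, Real.exp_add, mul_assoc]
    refine mul_le_mul (Real.exp_le_exp.2 hTB.1) ?_ ?_ (Real.exp_pos _).le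
    · rw [mul_add]
      exact add_le_add (mul_le_of_le_one_left (by positivity) hB2) hge
    · positivity

theorem exists_integral_u_le :
    ∃ C > 0, ∀ t ∈ Ici (0:ℝ), ∫ x in (0:ℝ)..1, S.u x t ≤ C := by
  have hu0 : 0 ≤ ∫ x in (0:ℝ)..1, S.u x 0 := intervalIntegral.integral_nonneg zero_le_one
    fun x hx => (S.hu_pos x hx 0 (mem_Ici.2 le_rfl)).le
  have hE : 0 ≤ S.E₀ := (intervalIntegral.integral_nonneg zero_le_one
    fun x hx => (S.hθ_pos x hx 0 (mem_Ici.2 le_rfl)).le).trans (S.integral_θ_le (mem_Ici.2 le_rfl))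
  refine ⟨Real.exp (2 * (2 * S.E₀ + 1)) * ((∫ x in (0:ℝ)..1, S.u x 0) + S.E₀) + 1,
    by positivity, fun T hT => ?_⟩
  have hT0 : 0 ≤ T := hT
  have hc : JointCont fun x t => Real.exp (t - T) * S.θ x t :=
    (JointCont.of_time (Continuous.continuousOn (by fun_prop))).mul S.jointCont_θ
  have hd : ContinuousOn (fun x => ∫ t in (0:ℝ)..T, Real.exp (t - T) * S.θ x t) (Icc 0 1) := by
    obtain ⟨F, hF, hFf⟩ := hc.exists_extension
    refine (intervalIntegral.continuous_parametric_intervalIntegral_of_continuous'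
      (f := F) hF 0 T).continuousOn.congr fun x hx => intervalIntegral.integral_congr fun t ht => ?_
    rw [uIcc_of_le hT0] at ht
    exact (hFf x hx t ht.1).symm
  have hdi := hd.intervalIntegrable_of_Icc (μ := volume) zero_le_one
  have hui := S.jointCont_u.intervalIntegrable_unit (mem_Ici.2 (le_refl (0:ℝ)))
  have hinner : ∫ t in (0:ℝ)..T, ∫ x in (0:ℝ)..1, Real.exp (t - T) * S.θ x t ≤ S.E₀ := by
    calc ∫ t in (0:ℝ)..T, ∫ x in (0:ℝ)..1, Real.exp (t - T) * S.θ x t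
        ≤ ∫ t in (0:ℝ)..T, Real.exp (t - T) * S.E₀ := by
          refine intervalIntegral.integral_mono_on hT0 (hc.intervalIntegrable_integral le_rfl hT0)
            (Continuous.intervalIntegrable (by fun_prop) _ _) fun t ht => ?_
          rw [intervalIntegral.integral_const_mul]
          exact mul_le_mul_of_nonneg_left (S.integral_θ_le ht.1) (Real.exp_pos _).le
      _ ≤ S.E₀ := by
          rw [intervalIntegral.integral_mul_const]
          exact mul_le_of_le_one_left hE (integral_exp_sub_le_one T)
  rw [← hc.integral_swap (by simp) hT0] at hinner
  have h := intervalIntegral.integral_mono_on zero_le_one (S.jointCont_u.intervalIntegrable_unit hT)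
    ((hui.add hdi).const_mul (Real.exp (2 * (2 * S.E₀ + 1)))) fun x hx => (S.u_bounds hx hT0).1
  rw [intervalIntegral.integral_const_mul, intervalIntegral.integral_add hui hdi] at h
  nlinarith [Real.exp_pos (2 * (2 * S.E₀ + 1))]

/-- Oscillation estimate for functions of the temperature. -/
theorem oscillation_sq_le {Ψ ψ φ : ℝ → ℝ} (hΨ : ∀ y > 0, HasDerivAt Ψ (ψ y) y)
    (hψ : ContinuousOn ψ (Ioi 0)) (hφ : ContinuousOn φ (Ioi 0))
    (hle : ∀ y > 0, ψ y ^ 2 ≤ φ y * y ^ S.β) {t x y : ℝ} (ht : t ∈ Ici (0:ℝ))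
    (hx : x ∈ Icc (0:ℝ) 1) (hy : y ∈ Icc (0:ℝ) 1) :
    (Ψ (S.θ x t) - Ψ (S.θ y t)) ^ 2 ≤
      (∫ z in (0:ℝ)..1, S.u z t) * ∫ z in (0:ℝ)..1, S.conduction φ z t := by
  wlog hxy : y ≤ x generalizing x y
  · rw [← neg_sub, neg_sq]
    exact this hy hx (le_of_not_ge hxy)
  have hf : JointCont fun z s => ψ (S.θ z s) * S.θx z s :=
    (S.jointCont_comp_θ hψ).mul S.jointCont_θx
  have hcond := S.jointCont_conduction hφ
  have hftc := integral_eq_sub_of_hasDerivWithinAt_unit (f := fun z => Ψ (S.θ z t))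
    (fun z hz => (hΨ _ (S.hθ_pos z hz t ht)).comp_hasDerivWithinAt z (S.hθx z hz t ht))
    (hf.slice_space ht) hy.1 hxy hx.2
  set I := Ψ (S.θ x t) - Ψ (S.θ y t) with hI
  set a := ∫ z in (0:ℝ)..1, S.u z t with ha
  set b := ∫ z in (0:ℝ)..1, S.conduction φ z t with hb
  have hcond0 : ∀ z ∈ Icc (0:ℝ) 1, (ψ (S.θ z t) * S.θx z t) ^ 2 / S.u z t ≤ S.conduction φ z t :=
    fun z hz => by
      unfold conduction
      rw [mul_pow, mul_div_assoc, mul_div_assoc, ← mul_assoc]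
      exact mul_le_mul_of_nonneg_right (hle _ (S.hθ_pos z hz t ht))
        (div_nonneg (sq_nonneg _) (S.hu_pos z hz t ht).le)
  have hapos : 0 < a := intervalIntegral.intervalIntegral_pos_of_pos_on
    (S.jointCont_u.intervalIntegrable_unit ht)
    (fun z hz => S.hu_pos z (Ioo_subset_Icc_self hz) t ht) zero_lt_one
  have hquad : ∀ l : ℝ, 2 * l * I ≤ l ^ 2 * a + b := fun l => by
    have hg := (S.jointCont_u.const_mul (l ^ 2)).add hcond
    have hpt : ∀ z ∈ Icc (0:ℝ) 1, 2 * l * (ψ (S.θ z t) * S.θx z t) ≤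
        l ^ 2 * S.u z t + S.conduction φ z t := fun z hz => by
      have hu := S.hu_pos z hz t ht
      refine le_trans ?_ (add_le_add_right (hcond0 z hz) _)
      have : 0 ≤ (l * S.u z t - ψ (S.θ z t) * S.θx z t) ^ 2 / S.u z t := by positivity
      have hexp : (l * S.u z t - ψ (S.θ z t) * S.θx z t) ^ 2 / S.u z t = l ^ 2 * S.u z t -
          2 * l * (ψ (S.θ z t) * S.θx z t) + (ψ (S.θ z t) * S.θx z t) ^ 2 / S.u z t := by
        field_simp
        ring
      linarith
    calc 2 * l * I = ∫ z in y..x, 2 * l * (ψ (S.θ z t) * S.θx z t) := by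
          rw [intervalIntegral.integral_const_mul, hftc]
      _ ≤ ∫ z in y..x, (l ^ 2 * S.u z t + S.conduction φ z t) :=
          intervalIntegral.integral_mono_on hxy
            ((hf.intervalIntegrable_space ht hy hx).const_mul _)
            (hg.intervalIntegrable_space ht hy hx)
            fun z hz => hpt z ⟨hy.1.trans hz.1, hz.2.trans hx.2⟩
      _ ≤ ∫ z in (0:ℝ)..1, (l ^ 2 * S.u z t + S.conduction φ z t) := by
          refine intervalIntegral.integral_mono_interval hy.1 hxy hx.2 ?_
            (hg.intervalIntegrable_unit ht)
          filter_upwards [ae_restrict_mem measurableSet_Ioc] with z hz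
          have hz' := Ioc_subset_Icc_self hz
          have hu := S.hu_pos z hz' t ht
          exact add_nonneg (by positivity) (le_trans (by positivity) (hcond0 z hz'))
      _ = l ^ 2 * a + b := by
          rw [(S.jointCont_u.const_mul (l ^ 2)).integral_add hcond ht,
            intervalIntegral.integral_const_mul]
  have h := hquad (I / a)
  have : I ^ 2 / a ≤ b := by
    have e : 2 * (I / a) * I - (I / a) ^ 2 * a = I ^ 2 / a := by
      field_simp
      ring
    linarith
  rw [div_le_iff₀ hapos] at this
  linarith

end NSSol

namespace NSSol

variable (S : NSSol)

theorem E₀_pos : 0 < S.E₀ :=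
  (intervalIntegral.intervalIntegral_pos_of_pos_on
    (S.jointCont_θ.intervalIntegrable_unit (mem_Ici.2 le_rfl))
    (fun x hx => S.hθ_pos x (Ioo_subset_Icc_self hx) 0 (mem_Ici.2 le_rfl)) zero_lt_one).trans_le
    (S.integral_θ_le (mem_Ici.2 le_rfl))

theorem conduction_nonneg {φ : ℝ → ℝ} (hφ : ∀ y > 0, 0 ≤ φ y) {x t : ℝ}
    (hx : x ∈ Icc (0:ℝ) 1) (ht : t ∈ Ici (0:ℝ)) : 0 ≤ S.conduction φ x t := by
  have hu := S.hu_pos x hx t ht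
  have hθ := S.hθ_pos x hx t ht
  have := hφ _ hθ
  unfold conduction
  positivity

theorem continuousOn_inv_sq : ContinuousOn (fun y : ℝ => (y ^ 2)⁻¹) (Ioi 0) :=
  (continuousOn_id.pow 2).inv₀ fun _ hy => pow_ne_zero 2 (ne_of_gt hy)

/-- The viscous part `(v_x − θ)²/(uθ)` of the entropy production. -/
noncomputable def viscousProduction (x t : ℝ) : ℝ := S.u x t * S.stress x t ^ 2 / S.θ x t

/-- The heat conduction part `θ^β θ_x²/(uθ²)` of the entropy production. -/
noncomputable def conductiveProduction (x t : ℝ) : ℝ := S.conduction (fun y => (y ^ 2)⁻¹) x t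

/-- The total entropy production. -/
noncomputable def production (t : ℝ) : ℝ :=
  ∫ x in (0:ℝ)..1, (S.viscousProduction x t + S.conductiveProduction x t)

theorem jointCont_viscousProduction : JointCont S.viscousProduction :=
  (S.jointCont_u.mul (S.jointCont_stress.pow 2)).div S.jointCont_θ
    fun x hx t ht => (S.hθ_pos x hx t ht).ne'

theorem jointCont_conductiveProduction : JointCont S.conductiveProduction :=
  S.jointCont_conduction continuousOn_inv_sq

theorem viscousProduction_nonneg {x t : ℝ} (hx : x ∈ Icc (0:ℝ) 1) (ht : t ∈ Ici (0:ℝ)) :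
    0 ≤ S.viscousProduction x t := by
  have hu := S.hu_pos x hx t ht
  have hθ := S.hθ_pos x hx t ht
  unfold viscousProduction
  positivity

theorem conductiveProduction_nonneg {x t : ℝ} (hx : x ∈ Icc (0:ℝ) 1) (ht : t ∈ Ici (0:ℝ)) :
    0 ≤ S.conductiveProduction x t :=
  S.conduction_nonneg (fun _ _ => by positivity) hx ht

theorem production_nonneg {t : ℝ} (ht : t ∈ Ici (0:ℝ)) : 0 ≤ S.production t :=
  intervalIntegral.integral_nonneg zero_le_one fun _ hx =>
    add_nonneg (S.viscousProduction_nonneg hx ht) (S.conductiveProduction_nonneg hx ht)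

theorem continuousOn_production : ContinuousOn S.production (Ici 0) :=
  (S.jointCont_viscousProduction.add S.jointCont_conductiveProduction).continuousOn_integral
    (by simp)

theorem intervalIntegrable_production {a b : ℝ} (ha : 0 ≤ a) (hb : 0 ≤ b) :
    IntervalIntegrable S.production volume a b :=
  (S.jointCont_viscousProduction.add S.jointCont_conductiveProduction).intervalIntegrable_integral
    ha hb

theorem entropy_balance {T : ℝ} (hT : 0 ≤ T) :
    (∫ x in (0:ℝ)..1, Real.log (S.θ x T)) - ∫ x in (0:ℝ)..1, Real.log (S.θ x 0) =
      (∫ t in (0:ℝ)..T, S.production t) + ∫ x in (0:ℝ)..1, S.impulse x T := by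
  have hD := S.jointCont_viscousProduction.add S.jointCont_conductiveProduction
  have hI : ∫ x in (0:ℝ)..1, S.impulse x T = ∫ t in (0:ℝ)..T, ∫ x in (0:ℝ)..1, S.stress x t := by
    rw [← S.jointCont_stress.integral_swap (by simp) hT]
    refine intervalIntegral.integral_congr fun x hx => ?_
    rw [uIcc_of_le zero_le_one] at hx
    exact S.impulse_eq hx hT
  unfold production
  rw [hI, ← hD.integral_integral_add S.jointCont_stress hT,
    S.temperature_test (G := Real.log) (g := fun y => y⁻¹) (g' := fun y => -(y ^ 2)⁻¹)
      (fun y hy => Real.hasDerivAt_log (ne_of_gt hy)) (fun y hy => hasDerivAt_inv (ne_of_gt hy))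
      continuousOn_inv_sq.neg hT]
  refine intervalIntegral.integral_congr fun t ht => intervalIntegral.integral_congr fun x hx => ?_
  rw [uIcc_of_le zero_le_one] at hx
  rw [uIcc_of_le hT] at ht
  have hθ := (S.hθ_pos x hx t ht.1).ne'
  have hu := S.u_ne_zero x hx t ht.1
  simp only [S.vx_eq hx ht.1, viscousProduction, conductiveProduction, conduction]
  field_simp
  ring

theorem exists_entropy_bounds : ∃ C > 0, ∃ L : ℝ, ∀ T ∈ Ici (0:ℝ),
    ∫ t in (0:ℝ)..T, S.production t ≤ C ∧ L ≤ ∫ x in (0:ℝ)..1, Real.log (S.θ x T) := by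
  set l₀ := ∫ x in (0:ℝ)..1, Real.log (S.θ x 0)
  have hlog : JointCont fun x t => Real.log (S.θ x t) :=
    S.jointCont_comp_θ fun y hy => (Real.continuousAt_log (ne_of_gt hy)).continuousWithinAt
  refine ⟨|S.E₀ - l₀ + (2 * S.E₀ + 1)| + 1, by positivity, l₀ - (2 * S.E₀ + 1), fun T hT => ?_⟩
  have hb := S.entropy_balance hT
  have hI : |∫ x in (0:ℝ)..1, S.impulse x T| ≤ 2 * S.E₀ + 1 := by
    have h := intervalIntegral.norm_integral_le_of_norm_le_const (a := (0:ℝ)) (b := 1)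
      (f := fun x => S.impulse x T) (C := 2 * S.E₀ + 1) fun x hx => by
        rw [uIoc_of_le zero_le_one] at hx
        exact S.abs_impulse_le (Ioc_subset_Icc_self hx) hT
    simpa using h
  have hI' := abs_le.1 hI
  have hlogle : ∫ x in (0:ℝ)..1, Real.log (S.θ x T) ≤ S.E₀ :=
    (hlog.integral_le S.jointCont_θ hT fun x hx =>
      Real.log_le_self (S.hθ_pos x hx T hT).le).trans (S.integral_θ_le hT)
  have hD : 0 ≤ ∫ t in (0:ℝ)..T, S.production t :=
    intervalIntegral.integral_nonneg hT fun t ht => S.production_nonneg ht.1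
  constructor
  · linarith [le_abs_self (S.E₀ - l₀ + (2 * S.E₀ + 1))]
  · linarith

theorem exists_rpow_oscillation_le : ∃ C > 0, ∀ t ∈ Ici (0:ℝ), ∀ x ∈ Icc (0:ℝ) 1,
    ∀ y ∈ Icc (0:ℝ) 1,
      (S.θ x t ^ (S.β / 2) - S.θ y t ^ (S.β / 2)) ^ 2 ≤ C * S.production t := by
  obtain ⟨C, hC, hu⟩ := S.exists_integral_u_le
  have hβ := S.hβ
  refine ⟨C * (S.β / 2) ^ 2, by positivity, fun t ht x hx y hy => ?_⟩
  have hφ := continuousOn_inv_sq.const_mul ((S.β / 2) ^ 2)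
  have h := S.oscillation_sq_le (Ψ := fun y => y ^ (S.β / 2))
    (ψ := fun y => S.β / 2 * y ^ (S.β / 2 - 1)) (φ := fun y => (S.β / 2) ^ 2 * (y ^ 2)⁻¹)
    (fun y hy => Real.hasDerivAt_rpow_const (Or.inl (ne_of_gt hy)))
    (fun y hy => ((Real.continuousAt_rpow_const y _ (Or.inl (ne_of_gt hy))).const_mul
      _).continuousWithinAt) hφ
    (fun y hy => by
      have e : y ^ (S.β / 2 - 1) * y ^ (S.β / 2 - 1) = (y ^ 2)⁻¹ * y ^ S.β := by
        rw [← Real.rpow_add hy, ← Real.rpow_natCast y 2, ← Real.rpow_neg (le_of_lt hy),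
          ← Real.rpow_add hy]
        congr 1
        push_cast
        ring
      rw [mul_pow, sq (y ^ (S.β / 2 - 1)), e, mul_assoc]) ht hx hy
  refine h.trans ?_
  rw [mul_assoc]
  refine mul_le_mul (hu t ht) ?_ (intervalIntegral.integral_nonneg zero_le_one fun z hz =>
    S.conduction_nonneg (fun _ _ => by positivity) hz ht) hC.le
  unfold production
  rw [← intervalIntegral.integral_const_mul]
  refine (S.jointCont_conduction hφ).integral_le
    ((S.jointCont_viscousProduction.add S.jointCont_conductiveProduction).const_mul _) ht
    fun z hz => ?_
  have h₁ : S.conduction (fun y => (S.β / 2) ^ 2 * (y ^ 2)⁻¹) z t =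
      (S.β / 2) ^ 2 * S.conductiveProduction z t := by
    simp only [conductiveProduction, conduction]
    ring
  rw [h₁]
  have h₂ := S.viscousProduction_nonneg hz ht
  exact mul_le_mul_of_nonneg_left (by linarith) (by positivity)

theorem exists_θ_lower_bound : ∃ m > 0, ∃ K > 0, ∀ t ∈ Ici (0:ℝ), ∀ x ∈ Icc (0:ℝ) 1,
    m - K * S.production t ≤ S.θ x t := by
  obtain ⟨_, _, L, hL⟩ := S.exists_entropy_bounds
  obtain ⟨C, hC, hosc⟩ := S.exists_rpow_oscillation_le
  have hβ := S.hβ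
  set q := Real.exp L ^ (S.β / 2) with hq
  have hq0 : 0 < q := by positivity
  set m := (q / 2) ^ (S.β / 2)⁻¹ with hm
  have hm0 : 0 < m := by positivity
  refine ⟨m, hm0, m * C / (q / 2) ^ 2, by positivity, fun t ht x hx => ?_⟩
  have hθ := S.hθ_pos x hx t ht
  by_contra! hlt
  have hlog : JointCont fun x t => Real.log (S.θ x t) :=
    S.jointCont_comp_θ fun y hy => (Real.continuousAt_log (ne_of_gt hy)).continuousWithinAt
  obtain ⟨y, hy, hyL⟩ := exists_le_of_le_integral_unit (hlog.slice_space ht) (hL t ht).2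
  have hθy : q ≤ S.θ y t ^ (S.β / 2) :=
    Real.rpow_le_rpow (Real.exp_pos _).le
      ((Real.le_log_iff_exp_le (S.hθ_pos y hy t ht)).1 hyL) (by positivity)
  have hxm : S.θ x t < m := hlt.trans_le (by
    have := S.production_nonneg ht
    have : 0 ≤ m * C / (q / 2) ^ 2 * S.production t := by positivity
    linarith)
  have hxq : S.θ x t ^ (S.β / 2) < q / 2 := by
    have h := Real.rpow_lt_rpow hθ.le hxm (z := S.β / 2) (by positivity)
    rwa [hm, ← Real.rpow_mul (by positivity), inv_mul_cancel₀ (by positivity), Real.rpow_one] at h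
  have hsmall : C * S.production t < (q / 2) ^ 2 := by
    have h : m * C / (q / 2) ^ 2 * S.production t < m := by linarith
    rw [div_mul_eq_mul_div, div_lt_iff₀ (by positivity), mul_assoc] at h
    exact lt_of_mul_lt_mul_left h hm0.le
  have h := hosc t ht y hy x hx
  have : (q / 2) ^ 2 ≤ (S.θ y t ^ (S.β / 2) - S.θ x t ^ (S.β / 2)) ^ 2 :=
    pow_le_pow_left₀ (by positivity) (by linarith) 2
  linarith

theorem exists_production_of_θ_large : ∃ K > 0, ∀ t ∈ Ici (0:ℝ), ∀ x ∈ Icc (0:ℝ) 1,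
    2 * S.E₀ < S.θ x t → 1 ≤ K * S.production t := by
  obtain ⟨C, hC, hosc⟩ := S.exists_rpow_oscillation_le
  have hβ := S.hβ
  have hE := S.E₀_pos
  set d := (2 * S.E₀) ^ (S.β / 2) - S.E₀ ^ (S.β / 2) with hd
  have hd0 : 0 < d :=
    sub_pos.2 (Real.rpow_lt_rpow hE.le (by linarith) (by positivity))
  refine ⟨C / d ^ 2, by positivity, fun t ht x hx hlarge => ?_⟩
  obtain ⟨y, hy, hyE⟩ := exists_ge_of_integral_unit_le (S.jointCont_θ.slice_space ht)
    (S.integral_θ_le ht)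
  have h₁ : S.θ y t ^ (S.β / 2) ≤ S.E₀ ^ (S.β / 2) :=
    Real.rpow_le_rpow (S.hθ_pos y hy t ht).le hyE (by positivity)
  have h₂ : (2 * S.E₀) ^ (S.β / 2) ≤ S.θ x t ^ (S.β / 2) :=
    Real.rpow_le_rpow (by positivity) hlarge.le (by positivity)
  have h₃ := hosc t ht x hx y hy
  have h₄ : d ^ 2 ≤ (S.θ x t ^ (S.β / 2) - S.θ y t ^ (S.β / 2)) ^ 2 :=
    pow_le_pow_left₀ hd0.le (by linarith) 2
  rw [div_mul_eq_mul_div, le_div_iff₀ (by positivity), one_mul]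
  exact h₄.trans h₃

theorem exists_u_lower_bound : ∃ c > 0, ∀ t ∈ Ici (0:ℝ), ∀ x ∈ Icc (0:ℝ) 1, c ≤ S.u x t := by
  obtain ⟨CD, hCD, L, hL⟩ := S.exists_entropy_bounds
  obtain ⟨m, hm, K, hK, hθ⟩ := S.exists_θ_lower_bound
  have h0 : (0:ℝ) ∈ Ici (0:ℝ) := mem_Ici.2 le_rfl
  obtain ⟨x₀, hx₀, hmin⟩ := isCompact_Icc.exists_isMinOn (nonempty_Icc.2 zero_le_one)
    (S.jointCont_u.slice_space h0)
  have hu₀ := S.hu_pos x₀ hx₀ 0 h0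
  set N := K * CD / m + 1 with hN
  have hN0 : 0 < N := by positivity
  refine ⟨Real.exp (-(2 * (2 * S.E₀ + 1))) * (Real.exp (-N) * min (S.u x₀ 0) m),
    by positivity, fun T hT x hx => ?_⟩
  have hT0 : 0 ≤ T := hT
  refine le_trans (mul_le_mul_of_nonneg_left ?_ (Real.exp_pos _).le) (S.u_bounds hx hT0).2
  have hux := S.hu_pos x hx 0 h0
  have hint : ∀ {a b : ℝ}, 0 ≤ a → 0 ≤ b →
      IntervalIntegrable (fun t => Real.exp (t - T) * S.θ x t) volume a b := fun ha hb =>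
    ((JointCont.of_time (Continuous.continuousOn (by fun_prop))).mul
      S.jointCont_θ).intervalIntegrable_time (f := fun x t => Real.exp (t - T) * S.θ x t) hx ha hb
  have hnn : ∀ t, 0 ≤ t → 0 ≤ Real.exp (t - T) * S.θ x t := fun t ht =>
    mul_nonneg (Real.exp_pos _).le (S.hθ_pos x hx t ht).le
  rcases le_total T N with hTN | hTN
  · have h₁ : Real.exp (-N) * min (S.u x₀ 0) m ≤ Real.exp (-T) * S.u x 0 :=
      mul_le_mul (Real.exp_le_exp.2 (by linarith)) ((min_le_left _ _).trans (hmin hx))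
        (by positivity) (Real.exp_pos _).le
    have h₂ : 0 ≤ ∫ t in (0:ℝ)..T, Real.exp (t - T) * S.θ x t :=
      intervalIntegral.integral_nonneg hT0 fun t ht => hnn t ht.1
    linarith
  · have hs : 0 ≤ T - N := by linarith
    have h₁ : 0 ≤ Real.exp (-T) * S.u x 0 := by positivity
    have h₂ : ∫ t in (T - N)..T, Real.exp (t - T) * S.θ x t ≤
        ∫ t in (0:ℝ)..T, Real.exp (t - T) * S.θ x t := by
      refine intervalIntegral.integral_mono_interval hs (by linarith) le_rfl ?_ (hint le_rfl hT0)
      filter_upwards [ae_restrict_mem measurableSet_Ioc] with t ht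
      exact hnn t ht.1.le
    have h₃ : ∫ t in (T - N)..T, S.production t ≤ ∫ t in (0:ℝ)..T, S.production t := by
      refine intervalIntegral.integral_mono_interval hs (by linarith) le_rfl ?_
        (S.intervalIntegrable_production le_rfl hT0)
      filter_upwards [ae_restrict_mem measurableSet_Ioc] with t ht
      exact S.production_nonneg ht.1.le
    have h₄ : ∫ t in (T - N)..T, Real.exp (-N) * (m - K * S.production t) ≤
        ∫ t in (T - N)..T, Real.exp (t - T) * S.θ x t := by
      refine intervalIntegral.integral_mono_on (by linarith)
        ((intervalIntegrable_const.sub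
          ((S.intervalIntegrable_production hs hT0).const_mul K)).const_mul _)
        (hint hs hT0) fun t ht => ?_
      have ht0 : t ∈ Ici (0:ℝ) := hs.trans ht.1
      have hθt := S.hθ_pos x hx t ht0
      exact (mul_le_mul_of_nonneg_left (hθ t ht0 x hx) (Real.exp_pos _).le).trans
        (mul_le_mul_of_nonneg_right (Real.exp_le_exp.2 (by linarith [ht.1])) hθt.le)
    rw [intervalIntegral.integral_const_mul, intervalIntegral.integral_sub intervalIntegrable_const
      ((S.intervalIntegrable_production hs hT0).const_mul K), intervalIntegral.integral_const_mul,
      intervalIntegral.integral_const] at h₄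
    simp only [sub_sub_cancel, smul_eq_mul] at h₄
    have h₅ : m ≤ N * m - K * ∫ t in (T - N)..T, S.production t := by
      have e : N * m = K * CD + m := by
        rw [hN]
        field_simp
      have := mul_le_mul_of_nonneg_left (h₃.trans (hL T hT).1) hK.le
      linarith
    have h₆ : Real.exp (-N) * min (S.u x₀ 0) m ≤
        Real.exp (-N) * (N * m - K * ∫ t in (T - N)..T, S.production t) :=
      mul_le_mul_of_nonneg_left ((min_le_right _ _).trans h₅) (Real.exp_pos _).le
    linarith

end NSSol

theorem hasDerivAt_comp_max {F F' : ℝ → ℝ} {M : ℝ} (hF : ∀ s, M ≤ s → HasDerivAt F (F' s) s)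
    (h0 : F' M = 0) (y : ℝ) : HasDerivAt (fun z => F (max z M)) (F' (max y M)) y := by
  rcases lt_trichotomy y M with h | h | h
  · rw [max_eq_right h.le, h0]
    refine (hasDerivAt_const y (F M)).congr_of_eventuallyEq ?_
    filter_upwards [Iio_mem_nhds h] with z hz
    rw [max_eq_right (le_of_lt hz)]
  · subst h
    rw [max_self, ← hasDerivWithinAt_univ, ← Iic_union_Ici (a := y)]
    refine HasDerivWithinAt.union ?_ ?_
    · rw [h0]
      refine (hasDerivWithinAt_const y (Iic y) (F y)).congr (fun z hz => ?_) (by rw [max_self])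
      rw [max_eq_right hz]
    · refine (hF y le_rfl).hasDerivWithinAt.congr (fun z hz => ?_) (by rw [max_self])
      rw [max_eq_left hz]
  · rw [max_eq_left h.le]
    refine (hF y h.le).congr_of_eventuallyEq ?_
    filter_upwards [Ioi_mem_nhds h] with z hz
    rw [max_eq_left (le_of_lt hz)]

theorem hasDerivAt_one_sub_div {M s : ℝ} (hs : s ≠ 0) :
    HasDerivAt (fun z => (1 - M / z) ^ 2) (2 * (1 - M / s) * (M / s ^ 2)) s := by
  refine ((((hasDerivAt_const s M).div (hasDerivAt_id s) hs).const_sub 1).pow 2).congr_deriv ?_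
  simp only [id]
  norm_num
  field_simp

/-- Weight functions of the temperature, supported above a threshold `M`, whose dissipation
controls a superlinear power of the temperature. -/
theorem exists_temperature_weight {β M : ℝ} (hβ : 0 < β) (hM : 0 < M) :
    ∃ G k k' Φ Ψ ψ : ℝ → ℝ, ∃ P > 0, ∃ Q > 0, ∃ A > 0,
      (∀ y > 0, HasDerivAt G (k y) y) ∧ (∀ y > 0, HasDerivAt k (k' y) y) ∧
      (∀ y > 0, HasDerivAt Ψ (ψ y) y) ∧ ContinuousOn k' (Ioi 0) ∧ ContinuousOn Φ (Ioi 0) ∧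
      ContinuousOn ψ (Ioi 0) ∧ (∀ y > 0, 0 ≤ G y ∧ G y ≤ P * y) ∧ (∀ y > 0, 0 ≤ k y ∧ k y ≤ P) ∧
      (∀ y ≤ M, k y = 0) ∧ (∀ y, 2 * M ≤ y → 1 / 4 ≤ k y) ∧ (∀ y > 0, 0 ≤ Φ y) ∧
      (∀ y > 0, k' y ≤ Q * (y ^ 2)⁻¹ - Φ y) ∧ (∀ y > 0, ψ y ^ 2 ≤ A * Φ y * y ^ β) ∧
      (∀ y ≤ M, Ψ y = 0) ∧ ∀ ε > 0, ∃ K > 0, ∀ y > M, y ≤ ε * Ψ y ^ 2 + K := by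
  set p := β / 2 with hp
  have hp0 : 0 < p := by positivity
  set a := 1 / 2 + β / 4 with ha
  have ha0 : 0 < a := by positivity
  set Fk : ℝ → ℝ := fun s => (1 - M / s) ^ 2 * (1 + s ^ (-p)) with hFk
  set FΦ : ℝ → ℝ := fun s => (1 - M / s) ^ 2 * (p * s ^ (-p - 1)) with hFΦ
  set Fk' : ℝ → ℝ := fun s => 2 * (1 - M / s) * (M / s ^ 2) * (1 + s ^ (-p)) - FΦ s with hFk'
  set FΨ : ℝ → ℝ := fun s => (1 - M / s) ^ 2 * s ^ a with hFΨ
  set Fψ : ℝ → ℝ := fun s => 2 * (1 - M / s) * (M / s ^ 2) * s ^ a +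
    (1 - M / s) ^ 2 * (a * s ^ (a - 1)) with hFψ
  have hmax0 : ∀ y : ℝ, 0 < max y M := fun y => lt_max_of_lt_right hM
  have hcont : ∀ {F : ℝ → ℝ}, ContinuousOn F (Ioi 0) → Continuous fun y => F (max y M) :=
    fun hF => hF.comp_continuous (by fun_prop) hmax0
  have hrpow : ∀ q : ℝ, ContinuousOn (fun s : ℝ => s ^ q) (Ioi 0) := fun q s hs =>
    (Real.continuousAt_rpow_const s q (Or.inl (ne_of_gt hs))).continuousWithinAt
  have hr : ContinuousOn (fun s : ℝ => 1 - M / s) (Ioi 0) :=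
    continuousOn_const.sub (continuousOn_const.div continuousOn_id fun s hs => ne_of_gt hs)
  have hMs : ContinuousOn (fun s : ℝ => M / s ^ 2) (Ioi 0) :=
    continuousOn_const.div (continuousOn_id.pow 2) fun s hs => pow_ne_zero 2 (ne_of_gt hs)
  have hFkc : ContinuousOn Fk (Ioi 0) := (hr.pow 2).mul (continuousOn_const.add (hrpow _))
  have hFΦc : ContinuousOn FΦ (Ioi 0) := (hr.pow 2).mul (continuousOn_const.mul (hrpow _))
  have hFk'c : ContinuousOn Fk' (Ioi 0) :=
    (((continuousOn_const.mul hr).mul hMs).mul (continuousOn_const.add (hrpow _))).sub hFΦc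
  have hFψc : ContinuousOn Fψ (Ioi 0) := (((continuousOn_const.mul hr).mul hMs).mul (hrpow _)).add
    ((hr.pow 2).mul (continuousOn_const.mul (hrpow _)))
  have hM1 : 1 - M / M = 0 := by rw [div_self hM.ne', sub_self]
  have hFkd : ∀ s, M ≤ s → HasDerivAt Fk (Fk' s) s := fun s hs => by
    have hs0 : s ≠ 0 := (hM.trans_le hs).ne'
    refine ((hasDerivAt_one_sub_div (M := M) hs0).mul
      ((Real.hasDerivAt_rpow_const (p := -p) (Or.inl hs0)).const_add 1)).congr_deriv ?_
    simp only [hFk', hFΦ]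
    ring
  have hFΨd : ∀ s, M ≤ s → HasDerivAt FΨ (Fψ s) s := fun s hs => by
    have hs0 : s ≠ 0 := (hM.trans_le hs).ne'
    exact (hasDerivAt_one_sub_div (M := M) hs0).mul
      (Real.hasDerivAt_rpow_const (p := a) (Or.inl hs0))
  have hr01 : ∀ s, M ≤ s → 0 ≤ 1 - M / s ∧ 1 - M / s ≤ 1 := fun s hs => by
    have hs0 := hM.trans_le hs
    have : M / s ≤ 1 := (div_le_one hs0).2 hs
    have : 0 < M / s := div_pos hM hs0
    constructor <;> linarith
  set P := 1 + M ^ (-p) with hP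
  have hP0 : 0 < P := by positivity
  have hsP : ∀ s, M ≤ s → 1 + s ^ (-p) ≤ P := fun s hs =>
    add_le_add_right (Real.rpow_le_rpow_of_nonpos hM hs (by linarith)) _
  have hFk0 : ∀ s, M ≤ s → 0 ≤ Fk s ∧ Fk s ≤ P := fun s hs => by
    have hs0 := hM.trans_le hs
    refine ⟨by positivity, ?_⟩
    exact (mul_le_of_le_one_left (by positivity)
      (pow_le_one₀ (hr01 s hs).1 (hr01 s hs).2)).trans (hsP s hs)
  have hkM : ∀ y ≤ M, Fk (max y M) = 0 := fun y hy => by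
    simp only [hFk, max_eq_right hy, hM1]
    simp
  have hkc := hcont hFkc
  refine ⟨fun y => ∫ z in M..y, Fk (max z M), fun y => Fk (max y M), fun y => Fk' (max y M),
    fun y => FΦ (max y M), fun y => FΨ (max y M), fun y => Fψ (max y M), P, hP0,
    2 * M * P, by positivity, (a + 2) ^ 2 / p, by positivity,
    fun y _ => intervalIntegral.integral_hasDerivAt_right (hkc.intervalIntegrable _ _)
      (hkc.stronglyMeasurableAtFilter _ _) hkc.continuousAt,
    fun y _ => hasDerivAt_comp_max hFkd (by simp [hFk', hFΦ, hM1]) y,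
    fun y _ => hasDerivAt_comp_max hFΨd (by simp [hFψ, hM1]) y,
    (hcont hFk'c).continuousOn, (hcont hFΦc).continuousOn, (hcont hFψc).continuousOn,
    fun y hy => ?_, fun y _ => hFk0 _ (le_max_right _ _), hkM, fun y hy => ?_, fun y _ => ?_,
    fun y hy => ?_, fun y hy => ?_, fun y hy => ?_, fun ε hε => ?_⟩
  · rcases le_total y M with h | h
    · have : ∫ z in M..y, Fk (max z M) = 0 := by
        rw [intervalIntegral.integral_congr (g := fun _ => 0) fun z hz => ?_]
        · simp
        · rw [uIcc_of_ge h] at hz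
          exact hkM z hz.2
      simp only [this]
      exact ⟨le_rfl, by positivity⟩
    · refine ⟨intervalIntegral.integral_nonneg h fun z _ => (hFk0 _ (le_max_right _ _)).1, ?_⟩
      have := intervalIntegral.integral_mono_on (μ := volume) h (hkc.intervalIntegrable _ _)
        (intervalIntegrable_const (c := P)) fun z _ => (hFk0 _ (le_max_right z M)).2
      simp only [intervalIntegral.integral_const, smul_eq_mul] at this
      nlinarith
  · have hyM : M ≤ y := by linarith
    have hy0 : 0 < y := by linarith
    have h₁ : M / y ≤ 1 / 2 := by
      rw [div_le_iff₀ hy0]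
      linarith
    have h₂ : (1 / 2 : ℝ) ^ 2 ≤ (1 - M / y) ^ 2 := pow_le_pow_left₀ (by norm_num) (by linarith) 2
    have h₃ : 0 < y ^ (-p) := by positivity
    simp only [hFk, max_eq_left hyM]
    nlinarith
  · have := hmax0 y
    simp only [hFΦ]
    positivity
  · rcases le_total y M with h | h
    · simp only [hFk', hFΦ, max_eq_right h, hM1]
      simp
      positivity
    · have hr' := hr01 y h
      simp only [hFk', max_eq_left h]
      refine sub_le_sub_right ?_ _
      calc 2 * (1 - M / y) * (M / y ^ 2) * (1 + y ^ (-p)) ≤ 2 * 1 * (M / y ^ 2) * P := by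
            refine mul_le_mul (mul_le_mul_of_nonneg_right (by linarith) (by positivity))
              (hsP y h) (by positivity) (by positivity)
        _ = 2 * M * P * (y ^ 2)⁻¹ := by
            field_simp
  · rcases le_total y M with h | h
    · simp [hFψ, hFΦ, max_eq_right h, hM1]
    · have hr' := hr01 y h
      simp only [hFψ, hFΦ, max_eq_left h]
      set r := 1 - M / y with hrdef
      have hMy : M / y ≤ 1 := (div_le_one hy).2 h
      have hMy0 : 0 < M / y := div_pos hM hy
      have e₁ : y ^ a = y ^ (a - 1) * y := by
        rw [← Real.rpow_add_one hy.ne', sub_add_cancel]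
      have e₂ : y ^ (-p - 1) * y ^ β = y ^ (a - 1) * y ^ (a - 1) := by
        rw [← Real.rpow_add hy, ← Real.rpow_add hy]
        congr 1
        rw [ha, hp]
        ring
      have e₃ : 2 * r * (M / y ^ 2) * y ^ a + r ^ 2 * (a * y ^ (a - 1)) =
          r * y ^ (a - 1) * (2 * (M / y) + a * r) := by
        rw [e₁]
        field_simp
      have e₄ : (a + 2) ^ 2 / p * (r ^ 2 * (p * y ^ (-p - 1))) * y ^ β =
          (r * y ^ (a - 1) * (a + 2)) ^ 2 := by
        have : (a + 2) ^ 2 / p * (r ^ 2 * (p * y ^ (-p - 1))) * y ^ β =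
            (a + 2) ^ 2 * r ^ 2 * (y ^ (-p - 1) * y ^ β) := by
          field_simp
        rw [this, e₂]
        ring
      rw [e₃, e₄]
      have hr0 := hr'.1
      have hya : 0 < y ^ (a - 1) := by positivity
      refine pow_le_pow_left₀ (by positivity) ?_ 2
      refine mul_le_mul_of_nonneg_left ?_ (by positivity)
      have := mul_le_of_le_one_right ha0.le hr'.2
      linarith
  · simp only [hFΨ, max_eq_right hy, hM1]
    simp
  · refine ⟨2 * M + (16 / ε) ^ p⁻¹, by positivity, fun y hy => ?_⟩
    have hy0 : 0 < y := hM.trans hy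
    simp only [hFΨ, max_eq_left (le_of_lt hy)]
    by_cases hc : y ≤ 2 * M + (16 / ε) ^ p⁻¹
    · have : 0 ≤ ε * ((1 - M / y) ^ 2 * y ^ a) ^ 2 := by positivity
      linarith
    · push Not at hc
      have hK : 0 < (16 / ε) ^ p⁻¹ := by positivity
      have h₁ : M / y ≤ 1 / 2 := by
        rw [div_le_iff₀ hy0]
        linarith
      have h₂ : (1 / 2 : ℝ) ^ 4 ≤ (1 - M / y) ^ 4 := pow_le_pow_left₀ (by norm_num) (by linarith) 4
      have h₃ : 16 / ε ≤ y ^ p := by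
        have := Real.rpow_le_rpow hK.le (show (16 / ε) ^ p⁻¹ ≤ y by linarith) hp0.le
        rwa [← Real.rpow_mul (by positivity), inv_mul_cancel₀ hp0.ne', Real.rpow_one] at this
      have h₄ : y ^ a * y ^ a = y * y ^ p := by
        rw [← Real.rpow_add hy0, mul_comm y, ← Real.rpow_add_one hy0.ne']
        congr 1
        rw [ha, hp]
        ring
      have h₅ : 16 ≤ ε * y ^ p := by
        rw [div_le_iff₀ hε] at h₃
        linarith
      have h₆ : ε * ((1 - M / y) ^ 2 * y ^ a) ^ 2 = (1 - M / y) ^ 4 * (y * (ε * y ^ p)) := by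
        rw [mul_pow, sq (y ^ a), h₄]
        ring
      rw [h₆]
      have h₇ : y * 16 ≤ y * (ε * y ^ p) := mul_le_mul_of_nonneg_left h₅ hy0.le
      have h₈ : (1 / 2 : ℝ) ^ 4 * (y * 16) ≤ (1 - M / y) ^ 4 * (y * (ε * y ^ p)) :=
        mul_le_mul h₂ h₇ (by positivity) (by positivity)
      have : (1 / 2 : ℝ) ^ 4 * (y * 16) = y := by ring
      have h₉ : 0 < 2 * M := by positivity
      linarith

namespace NSSol

variable (S : NSSol)

/-- The viscous dissipation weighted by a function of the temperature. -/
noncomputable def weightedStress (k : ℝ → ℝ) (x t : ℝ) : ℝ :=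
  k (S.θ x t) * (S.u x t * S.stress x t ^ 2)

theorem jointCont_weightedStress {k : ℝ → ℝ} (hk : ContinuousOn k (Ioi 0)) :
    JointCont (S.weightedStress k) :=
  (S.jointCont_comp_θ hk).mul (S.jointCont_u.mul (S.jointCont_stress.pow 2))

theorem weightedStress_nonneg {k : ℝ → ℝ} (hk : ∀ y > 0, 0 ≤ k y) {x t : ℝ}
    (hx : x ∈ Icc (0:ℝ) 1) (ht : t ∈ Ici (0:ℝ)) : 0 ≤ S.weightedStress k x t := by
  have hu := S.hu_pos x hx t ht
  have := hk _ (S.hθ_pos x hx t ht)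
  unfold weightedStress
  positivity

theorem integral_conductiveProduction_le {t : ℝ} (ht : t ∈ Ici (0:ℝ)) :
    ∫ x in (0:ℝ)..1, S.conductiveProduction x t ≤ S.production t :=
  S.jointCont_conductiveProduction.integral_le
    (S.jointCont_viscousProduction.add S.jointCont_conductiveProduction) ht fun _ hx =>
      le_add_of_nonneg_left (S.viscousProduction_nonneg hx ht)

theorem exists_θ_le {Φ Ψ ψ : ℝ → ℝ} {A : ℝ} (hΨ : ∀ y > 0, HasDerivAt Ψ (ψ y) y)
    (hψ : ContinuousOn ψ (Ioi 0)) (hΦ : ContinuousOn Φ (Ioi 0))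
    (hle : ∀ y > 0, ψ y ^ 2 ≤ A * Φ y * y ^ S.β) (hA : 0 < A) (hΦ0 : ∀ y > 0, 0 ≤ Φ y)
    (hΨ0 : ∀ y ≤ 2 * S.E₀, Ψ y = 0)
    (hgrowth : ∀ ε > 0, ∃ K > 0, ∀ y > 2 * S.E₀, y ≤ ε * Ψ y ^ 2 + K) {ε : ℝ} (hε : 0 < ε) :
    ∃ K > 0, ∀ t ∈ Ici (0:ℝ), ∀ x ∈ Icc (0:ℝ) 1, 2 * S.E₀ < S.θ x t →
      S.θ x t ≤ ε * (∫ y in (0:ℝ)..1, S.conduction Φ y t) + K * S.production t := by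
  obtain ⟨C, hC, hu⟩ := S.exists_integral_u_le
  obtain ⟨K₀, hK₀, hprod⟩ := S.exists_production_of_θ_large
  obtain ⟨K, hK, hg⟩ := hgrowth (ε / (C * A)) (by positivity)
  refine ⟨K * K₀, by positivity, fun t ht x hx hθ => ?_⟩
  obtain ⟨y, hy, hyE⟩ := exists_ge_of_integral_unit_le (S.jointCont_θ.slice_space ht)
    (S.integral_θ_le ht)
  have hE := S.E₀_pos
  have hW : 0 ≤ ∫ y in (0:ℝ)..1, S.conduction Φ y t :=
    intervalIntegral.integral_nonneg zero_le_one fun _ hz => S.conduction_nonneg hΦ0 hz ht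
  have hosc := S.oscillation_sq_le hΨ hψ (φ := fun y => A * Φ y) (hΦ.const_mul A) hle ht hx hy
  have hcond : ∫ z in (0:ℝ)..1, S.conduction (fun y => A * Φ y) z t =
      A * ∫ z in (0:ℝ)..1, S.conduction Φ z t := by
    rw [← intervalIntegral.integral_const_mul]
    refine intervalIntegral.integral_congr fun z _ => ?_
    simp only [conduction]
    ring
  rw [hΨ0 _ (by linarith : S.θ y t ≤ 2 * S.E₀), sub_zero, hcond] at hosc
  calc S.θ x t ≤ ε / (C * A) * Ψ (S.θ x t) ^ 2 + K * 1 := by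
        rw [mul_one]
        exact hg _ hθ
    _ ≤ ε / (C * A) * (C * (A * ∫ z in (0:ℝ)..1, S.conduction Φ z t)) +
          K * (K₀ * S.production t) := by
        gcongr
        · exact hosc.trans (mul_le_mul_of_nonneg_right (hu t ht) (by positivity))
        · exact hprod t ht x hx hθ
    _ = _ := by
        field_simp

theorem weightedStress_le {k k' Φ : ℝ → ℝ} {Q H x t : ℝ} (hx : x ∈ Icc (0:ℝ) 1)
    (ht : t ∈ Ici (0:ℝ)) (hk0 : 0 ≤ k (S.θ x t))
    (hk' : ∀ y > 0, k' y ≤ Q * (y ^ 2)⁻¹ - Φ y)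
    (hH : k (S.θ x t) * S.θ x t ≤ S.u x t * H) :
    1 / 2 * S.weightedStress k x t + S.conduction Φ x t + -(H / 2) * S.θ x t +
        -Q * S.conductiveProduction x t ≤
      k (S.θ x t) * (S.stress x t * S.vx x t) - S.conduction k' x t := by
  have hu := S.hu_pos x hx t ht
  have hθ := S.hθ_pos x hx t ht
  have h₁ : S.conduction k' x t ≤ Q * S.conductiveProduction x t - S.conduction Φ x t := by
    simp only [conductiveProduction, conduction]
    rw [← mul_assoc, ← sub_mul]
    exact mul_le_mul_of_nonneg_right (hk' _ hθ) (by positivity)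
  have h₂ : -(k (S.θ x t) * (S.u x t * S.stress x t ^ 2)) - H * S.θ x t ≤
      2 * (k (S.θ x t) * S.stress x t * S.θ x t) := by
    refine le_of_mul_le_mul_left ?_ hu
    have e₁ := mul_le_mul_of_nonneg_right hH hθ.le
    have e₂ := mul_nonneg hk0 (sq_nonneg (S.u x t * S.stress x t + S.θ x t))
    nlinarith
  rw [S.vx_eq hx ht, weightedStress]
  linarith

/-- The viscous dissipation at large temperatures is integrable over space-time, and the excess of
the temperature is bounded by an integrable function of time. -/
theorem exists_weightedStress_bound : ∃ k D : ℝ → ℝ, ∃ C > 0, ContinuousOn k (Ioi 0) ∧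
    ContinuousOn D (Ici 0) ∧ (∀ y > 0, 0 ≤ k y) ∧ (∀ y, 4 * S.E₀ ≤ y → 1 / 4 ≤ k y) ∧
    (∀ t ∈ Ici (0:ℝ), ∀ x ∈ Icc (0:ℝ) 1, S.θ x t ≤ 2 * S.E₀ + D t) ∧
    (∀ t ∈ Ici (0:ℝ), 0 ≤ D t) ∧
    ∀ T ∈ Ici (0:ℝ), ∫ t in (0:ℝ)..T, ∫ x in (0:ℝ)..1, S.weightedStress k x t ≤ C ∧
      ∫ t in (0:ℝ)..T, D t ≤ C := by
  have hE := S.E₀_pos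
  obtain ⟨G, k, k', Φ, Ψ, ψ, P, hP, Q, hQ, A, hA, hG, hk, hΨ, hk'c, hΦc, hψc, hGP, hkP, hkM, hk2M,
    hΦ0, hk', hψΦ, hΨ0, hgrowth⟩ := exists_temperature_weight S.hβ (M := 2 * S.E₀) (by positivity)
  obtain ⟨c, hc, huc⟩ := S.exists_u_lower_bound
  obtain ⟨C₀, hC₀, L, hL⟩ := S.exists_entropy_bounds
  have hbound := fun {ε : ℝ} => S.exists_θ_le (ε := ε) hΨ hψc hΦc hψΦ hA hΦ0 hΨ0 hgrowth
  obtain ⟨K₁, hK₁, hθ₁⟩ := hbound one_pos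
  obtain ⟨K, hK, hθK⟩ := hbound (ε := c / (P * S.E₀)) (by positivity)
  have hkc : ContinuousOn k (Ioi 0) := fun y hy => (hk y hy).continuousAt.continuousWithinAt
  have hGc : ContinuousOn G (Ioi 0) := fun y hy => (hG y hy).continuousAt.continuousWithinAt
  set W : ℝ → ℝ := fun t => ∫ x in (0:ℝ)..1, S.conduction Φ x t with hW
  set Z : ℝ → ℝ := fun t => ∫ x in (0:ℝ)..1, S.weightedStress k x t with hZ
  have hW0 : ∀ t ∈ Ici (0:ℝ), 0 ≤ W t := fun t ht =>
    intervalIntegral.integral_nonneg zero_le_one fun _ hx => S.conduction_nonneg hΦ0 hx ht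
  have hZ0 : ∀ t ∈ Ici (0:ℝ), 0 ≤ Z t := fun t ht =>
    intervalIntegral.integral_nonneg zero_le_one fun _ hx =>
      S.weightedStress_nonneg (fun y hy => (hkP y hy).1) hx ht
  have hWc : ContinuousOn W (Ici 0) := (S.jointCont_conduction hΦc).continuousOn_integral (by simp)
  have hZc : ContinuousOn Z (Ici 0) :=
    (S.jointCont_weightedStress hkc).continuousOn_integral (by simp)
  have hint : ∀ {f : ℝ → ℝ} {T : ℝ}, ContinuousOn f (Ici 0) → 0 ≤ T →
      IntervalIntegrable f volume 0 T := fun hf hT =>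
    (hf.mono Icc_subset_Ici_self).intervalIntegrable_of_Icc hT
  set R := Q + S.E₀ * (P / c * K) / 2 with hR
  have hR0 : 0 < R := by positivity
  have hspace : ∀ t ∈ Ici (0:ℝ), 1 / 2 * (Z t + W t) - R * S.production t ≤
      ∫ x in (0:ℝ)..1, (k (S.θ x t) * (S.stress x t * S.vx x t) - S.conduction k' x t) := by
    intro t ht
    have hprod := S.production_nonneg ht
    set H := P / c * (c / (P * S.E₀) * W t + K * S.production t) with hH
    have hH0 : 0 ≤ H := by
      have := hW0 t ht
      positivity
    have hpt : ∀ x ∈ Icc (0:ℝ) 1, k (S.θ x t) * S.θ x t ≤ S.u x t * H := by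
      intro x hx
      have hu := S.hu_pos x hx t ht
      have hθ := S.hθ_pos x hx t ht
      rcases le_or_gt (S.θ x t) (2 * S.E₀) with h | h
      · rw [hkM _ h, zero_mul]
        positivity
      · calc k (S.θ x t) * S.θ x t
            ≤ P * (c / (P * S.E₀) * W t + K * S.production t) :=
              mul_le_mul (hkP _ hθ).2 (hθK t ht x hx h) hθ.le hP.le
          _ = c * H := by
              rw [hH]
              field_simp
          _ ≤ S.u x t * H := mul_le_mul_of_nonneg_right (huc t ht x hx) hH0
    have hZi := (S.jointCont_weightedStress hkc).const_mul (1 / 2)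
    have hWi := S.jointCont_conduction hΦc
    have hθi := S.jointCont_θ.const_mul (-(H / 2))
    have hCi := S.jointCont_conductiveProduction.const_mul (-Q)
    have hle := (((hZi.add hWi).add hθi).add hCi).integral_le
      (((S.jointCont_comp_θ hkc).mul (S.jointCont_stress.mul S.jointCont_vx)).sub
        (S.jointCont_conduction hk'c)) ht fun x hx =>
      S.weightedStress_le hx ht (hkP _ (S.hθ_pos x hx t ht)).1 hk' (hpt x hx)
    rw [((hZi.add hWi).add hθi).integral_add hCi ht, (hZi.add hWi).integral_add hθi ht,
      hZi.integral_add hWi ht] at hle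
    simp only [intervalIntegral.integral_const_mul] at hle
    refine le_trans ?_ hle
    have h₁ := mul_le_mul_of_nonneg_left (S.integral_θ_le ht) (by positivity : 0 ≤ H / 2)
    have h₂ := mul_le_mul_of_nonneg_left (S.integral_conductiveProduction_le ht) hQ.le
    have h₃ : H / 2 * S.E₀ = 1 / 2 * W t + S.E₀ * (P / c * K) / 2 * S.production t := by
      rw [hH]
      field_simp
    have h₄ : R * S.production t =
        Q * S.production t + S.E₀ * (P / c * K) / 2 * S.production t := by
      rw [hR]
      ring
    change 1 / 2 * (Z t + W t) - R * S.production t ≤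
      1 / 2 * Z t + W t + -(H / 2) * (∫ x in (0:ℝ)..1, S.θ x t) +
        -Q * ∫ x in (0:ℝ)..1, S.conductiveProduction x t
    linarith
  have htime : ∀ T ∈ Ici (0:ℝ), (∫ t in (0:ℝ)..T, Z t) + ∫ t in (0:ℝ)..T, W t ≤
      2 * (P * S.E₀ + R * C₀) := by
    intro T hT
    have hmono := intervalIntegral.integral_mono_on (μ := volume) (mem_Ici.1 hT)
      (f := fun t => 1 / 2 * (Z t + W t) - R * S.production t)
      (hint (((hZc.add hWc).const_mul (1 / 2)).sub (S.continuousOn_production.const_mul R)) hT)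
      ((((S.jointCont_comp_θ hkc).mul (S.jointCont_stress.mul S.jointCont_vx)).sub
        (S.jointCont_conduction hk'c)).intervalIntegrable_integral le_rfl hT)
      fun t ht => hspace t ht.1
    rw [← S.temperature_test hG hk hk'c hT, intervalIntegral.integral_sub
      (hint (f := fun t => 1 / 2 * (Z t + W t)) ((hZc.add hWc).const_mul (1 / 2)) hT)
      (hint (S.continuousOn_production.const_mul R) hT),
      intervalIntegral.integral_const_mul, intervalIntegral.integral_const_mul,
      intervalIntegral.integral_add (hint hZc hT) (hint hWc hT)] at hmono
    have h₁ : 0 ≤ ∫ x in (0:ℝ)..1, G (S.θ x 0) := intervalIntegral.integral_nonneg zero_le_one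
      fun x hx => (hGP _ (S.hθ_pos x hx 0 (mem_Ici.2 le_rfl))).1
    have h₂ := (S.jointCont_comp_θ hGc).integral_le (S.jointCont_θ.const_mul P) hT
      fun x hx => (hGP _ (S.hθ_pos x hx T hT)).2
    rw [intervalIntegral.integral_const_mul] at h₂
    have h₃ := mul_le_mul_of_nonneg_left (S.integral_θ_le hT) hP.le
    have h₄ := mul_le_mul_of_nonneg_left (hL T hT).1 hR0.le
    linarith
  have hnn : ∀ {f : ℝ → ℝ} {T : ℝ}, (∀ t ∈ Ici (0:ℝ), 0 ≤ f t) → 0 ≤ T →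
      0 ≤ ∫ t in (0:ℝ)..T, f t := fun hf hT =>
    intervalIntegral.integral_nonneg hT fun t ht => hf t ht.1
  refine ⟨k, fun t => 1 * W t + K₁ * S.production t, 2 * (P * S.E₀ + R * C₀) + K₁ * C₀,
    by positivity, hkc, (hWc.const_mul 1).add (S.continuousOn_production.const_mul K₁),
    fun y hy => (hkP y hy).1, fun y hy => hk2M y (by linarith), fun t ht x hx => ?_,
    fun t ht => ?_, fun T hT => ?_⟩
  · have h₁ := hW0 t ht
    have h₂ := mul_nonneg hK₁.le (S.production_nonneg ht)
    rcases le_or_gt (S.θ x t) (2 * S.E₀) with h | h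
    · linarith
    · linarith [hθ₁ t ht x hx h]
  · have h₁ := hW0 t ht
    have h₂ := mul_nonneg hK₁.le (S.production_nonneg ht)
    linarith
  · rw [intervalIntegral.integral_add (hint (hWc.const_mul 1) hT)
      (hint (S.continuousOn_production.const_mul K₁) hT), intervalIntegral.integral_const_mul,
      intervalIntegral.integral_const_mul]
    have h₁ := htime T hT
    have h₂ := mul_le_mul_of_nonneg_left (hL T hT).1 hK₁.le
    have h₃ := hnn hZ0 hT
    have h₄ := hnn hW0 hT
    have h₅ : 0 < K₁ * C₀ := by positivity
    constructor <;> linarith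

theorem exists_u_upper_bound : ∃ C > 0, ∀ t ∈ Ici (0:ℝ), ∀ x ∈ Icc (0:ℝ) 1, S.u x t ≤ C := by
  have hE := S.E₀_pos
  obtain ⟨k, D, C, hC, -, hDc, -, -, hθ, hD0, hbound⟩ := S.exists_weightedStress_bound
  obtain ⟨z, hz, hmax⟩ := isCompact_Icc.exists_isMaxOn (nonempty_Icc.2 zero_le_one)
    (S.jointCont_u.slice_space (mem_Ici.2 le_rfl))
  have hz0 := S.hu_pos z hz 0 (mem_Ici.2 le_rfl)
  refine ⟨Real.exp (2 * (2 * S.E₀ + 1)) * (S.u z 0 + (2 * S.E₀ + C)), by positivity,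
    fun T hT x hx => (S.u_bounds hx hT).1.trans ?_⟩
  have hT0 : 0 ≤ T := hT
  have hexp : IntervalIntegrable (fun t => 2 * S.E₀ * Real.exp (t - T)) volume 0 T :=
    Continuous.intervalIntegrable (by fun_prop) _ _
  have hDi : IntervalIntegrable D volume 0 T :=
    (hDc.mono Icc_subset_Ici_self).intervalIntegrable_of_Icc hT0
  have hθi : IntervalIntegrable (fun t => Real.exp (t - T) * S.θ x t) volume 0 T :=
    (S.jointCont_θ.intervalIntegrable_time hx le_rfl hT0).continuousOn_mul (by fun_prop)
  refine mul_le_mul_of_nonneg_left (add_le_add (hmax hx) ?_) (Real.exp_pos _).le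
  calc ∫ t in (0:ℝ)..T, Real.exp (t - T) * S.θ x t
      ≤ ∫ t in (0:ℝ)..T, (2 * S.E₀ * Real.exp (t - T) + D t) := by
        refine intervalIntegral.integral_mono_on hT0 hθi (hexp.add hDi) fun t ht => ?_
        have h₁ : Real.exp (t - T) ≤ 1 := Real.exp_le_one_iff.2 (by linarith [ht.2])
        have h₂ := mul_le_mul_of_nonneg_left (hθ t ht.1 x hx) (Real.exp_pos (t - T)).le
        have h₃ := mul_le_mul_of_nonneg_right h₁ (hD0 t ht.1)
        linarith
    _ = 2 * S.E₀ * (∫ t in (0:ℝ)..T, Real.exp (t - T)) + ∫ t in (0:ℝ)..T, D t := by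
        rw [intervalIntegral.integral_add hexp hDi, intervalIntegral.integral_const_mul]
    _ ≤ 2 * S.E₀ * 1 + C := by
        gcongr
        · exact integral_exp_sub_le_one T
        · exact (hbound T hT).2
    _ = 2 * S.E₀ + C := by ring

theorem sq_vx_sub_θ_le {k : ℝ → ℝ} {M B x t : ℝ} (hx : x ∈ Icc (0:ℝ) 1) (ht : t ∈ Ici (0:ℝ))
    (hk : ∀ y > 0, 0 ≤ k y) (hkM : ∀ y, M ≤ y → 1 / 4 ≤ k y) (hM : 0 < M) (hB : S.u x t ≤ B) :
    (S.vx x t - S.θ x t) ^ 2 ≤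
      B * M * S.viscousProduction x t + B * 4 * S.weightedStress k x t := by
  have hu := S.hu_pos x hx t ht
  have hθ := S.hθ_pos x hx t ht
  have hs : 0 ≤ S.u x t * S.stress x t ^ 2 := by positivity
  have hv := S.viscousProduction_nonneg hx ht
  have hw := S.weightedStress_nonneg hk hx ht
  have hmain : S.u x t * S.stress x t ^ 2 ≤
      M * S.viscousProduction x t + 4 * S.weightedStress k x t := by
    rcases le_total M (S.θ x t) with h | h
    · have := mul_le_mul_of_nonneg_right (hkM _ h) hs
      have := mul_nonneg hM.le hv
      unfold weightedStress
      linarith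
    · have h₁ : S.θ x t * S.viscousProduction x t = S.u x t * S.stress x t ^ 2 := by
        unfold viscousProduction
        field_simp
      have := mul_le_mul_of_nonneg_right h hv
      linarith
  calc (S.vx x t - S.θ x t) ^ 2 = S.u x t * (S.u x t * S.stress x t ^ 2) := by
        rw [S.vx_eq hx ht]
        ring
    _ ≤ B * (M * S.viscousProduction x t + 4 * S.weightedStress k x t) :=
        mul_le_mul hB hmain hs (hu.le.trans hB)
    _ = _ := by ring

end NSSol

/-- Space-time bound on the effective viscous flux variable:
`∫₀ᵀ∫₀¹ (w_x + u − θ)² dx dt ≤ C`, where `w_x + u − θ = v_x − θ`. -/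
theorem stress_L2_spacetime_bound (S : NSSol) :
    ∃ C > (0:ℝ), ∀ T > (0:ℝ),
      (∫ t in (0:ℝ)..T, ∫ x in (0:ℝ)..1, (S.vx x t - S.θ x t) ^ 2) ≤ C := by
  have hE := S.E₀_pos
  obtain ⟨k, _, C₁, hC₁, hkc, -, hk, hkM, -, -, hweighted⟩ := S.exists_weightedStress_bound
  obtain ⟨C₂, hC₂, L, hproduction⟩ := S.exists_entropy_bounds
  obtain ⟨B, hB, hu⟩ := S.exists_u_upper_bound
  have hv := S.jointCont_viscousProduction.const_mul (B * (4 * S.E₀))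
  have hw := (S.jointCont_weightedStress hkc).const_mul (B * 4)
  refine ⟨B * (4 * S.E₀) * C₂ + B * 4 * C₁, by positivity, fun T hT => ?_⟩
  have hle := ((S.jointCont_vx.sub S.jointCont_θ).pow 2).integral_integral_le (hv.add hw) hT.le
    fun x hx t ht => S.sq_vx_sub_θ_le hx ht hk hkM (by positivity) (hu t ht x hx)
  refine hle.trans ?_
  rw [hv.integral_integral_add hw hT.le]
  simp only [intervalIntegral.integral_const_mul]
  gcongr
  · refine le_trans ?_ (hproduction T hT.le).1
    exact S.jointCont_viscousProduction.integral_integral_le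
      (S.jointCont_viscousProduction.add S.jointCont_conductiveProduction) hT.le
      fun x hx t ht => le_add_of_nonneg_right (S.conductiveProduction_nonneg hx ht)
  · exact (hweighted T hT.le).1
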